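/- arXiv:1509.02801 — 12 statements merged into one kernel-verified Lean document; each statement's English description precedes it below -/
import Mathlib

section
/- Let n and k be integers with 3 ≤ n and 2 ≤ k ≤ n. For the cycle C_n on n vertices, sdiam_k(C_n) = ⌊n(k−1)/k⌋. -/
open SimpleGraph

/-- Steiner distance of a set of vertices `S` in `G`: the minimum number of edges of a
connected subgraph of `G` whose vertex set contains `S`. -/
noncomputable def steinerDist {V : Type*} (G : SimpleGraph V) (S : Set V) : ℕ :=
  sInf {m | ∃ H : G.Subgraph, H.Connected ∧ S ⊆ H.verts ∧ H.edgeSet.ncard = m}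

/-- Steiner `k`-diameter of `G`: the maximum Steiner distance over all `k`-element
subsets of the vertex set. -/
noncomputable def steinerDiam {V : Type*} [Fintype V] [DecidableEq V]
    (G : SimpleGraph V) (k : ℕ) : ℕ :=
  (Finset.univ.powersetCard k).sup (fun S : Finset V => steinerDist G (S : Set V))

lemma cyc_adj {n : ℕ} (hn : 3 ≤ n) (u v : Fin n) :
    (cycleGraph n).Adj u v ↔ (u.val + 1 = v.val ∨ v.val + 1 = u.val ∨
      (u.val = 0 ∧ v.val + 1 = n) ∨ (v.val = 0 ∧ u.val + 1 = n)) := by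
  have hu := u.isLt
  have hv := v.isLt
  have key : ∀ a b : Fin n, (a - b).val = if b.val ≤ a.val then a.val - b.val
      else n - b.val + a.val := by
    intro a b
    have ha := a.isLt
    have hb := b.isLt
    split_ifs with h
    · exact Fin.sub_val_of_le h
    · rw [Fin.sub_def]
      exact Nat.mod_eq_of_lt (by omega)
  rw [cycleGraph_adj', key, key]
  split_ifs <;> omega

def cycPt (n : ℕ) (hn : 3 ≤ n) (i : ℕ) : Fin n := ⟨i % n, Nat.mod_lt _ (by omega)⟩

lemma cycPt_adj {n : ℕ} (hn : 3 ≤ n) (i : ℕ) :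
    (cycleGraph n).Adj (cycPt n hn i) (cycPt n hn (i + 1)) := by
  rw [cyc_adj hn]
  simp only [cycPt]
  have h := Nat.mod_lt i (show n > 0 by omega)
  rw [Nat.add_mod, Nat.mod_eq_of_lt (show 1 < n by omega)]
  by_cases h1 : i % n + 1 = n
  · rw [h1, Nat.mod_self]; omega
  · rw [Nat.mod_eq_of_lt (show i % n + 1 < n by omega)]; omega

lemma cyc_walk {n : ℕ} (hn : 3 ≤ n) (m : ℕ) : ∀ i : ℕ,
    ∃ (b : Fin n) (w : (cycleGraph n).Walk (cycPt n hn i) b), w.length = m ∧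
      ∀ j ≤ m, cycPt n hn (i + j) ∈ w.support := by
  induction m with
  | zero =>
    intro i
    refine ⟨_, Walk.nil, rfl, ?_⟩
    intro j hj
    obtain rfl : j = 0 := by omega
    simp
  | succ m ih =>
    intro i
    obtain ⟨b, w, hw, hs⟩ := ih (i + 1)
    refine ⟨b, Walk.cons (cycPt_adj hn i) w, by simp [hw], ?_⟩
    intro j hj
    rcases j with _ | j
    · simp
    · rw [Walk.support_cons]
      refine List.mem_cons_of_mem _ ?_
      have := hs j (by omega)
      rwa [show i + 1 + j = i + (j + 1) by ring] at this

lemma cyc_gap {n k c : ℕ} (hn : 3 ≤ n) (hc : c ≤ n) (h : k * (c - 1) < n)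
    (S : Finset (Fin n)) (hS : S.card = k) :
    ∃ a : ℕ, ∀ j, 1 ≤ j → j < c → cycPt n hn (a + j) ∉ S := by
  by_contra hcon
  push Not at hcon
  have hsub : (Finset.univ : Finset (Fin n)) ⊆
      (S ×ˢ Finset.Ico 1 c).image (fun p => cycPt n hn (p.1.val + (n - p.2))) := by
    intro v _
    obtain ⟨j, h1, h2, h3⟩ := hcon v.val
    rw [Finset.mem_image]
    refine ⟨(cycPt n hn (v.val + j), j), by simp [h1, h2, h3], ?_⟩
    apply Fin.ext
    simp only [cycPt]
    rw [Nat.mod_add_mod, show v.val + j + (n - j) = v.val + n by omega, Nat.add_mod_right,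
      Nat.mod_eq_of_lt v.isLt]
  have := (Finset.card_le_card hsub).trans Finset.card_image_le
  rw [Finset.card_product, Nat.card_Ico, hS, Finset.card_univ, Fintype.card_fin] at this
  omega

lemma cyc_upper {n k c : ℕ} (hn : 3 ≤ n) (hc : c ≤ n) (h : k * (c - 1) < n)
    (S : Finset (Fin n)) (hS : S.card = k) :
    steinerDist (cycleGraph n) (S : Set (Fin n)) ≤ n - c := by
  obtain ⟨a, ha⟩ := cyc_gap hn hc h S hS
  obtain ⟨b, w, hw, hs⟩ := cyc_walk hn (n - c) (a + c)
  have hle : w.toSubgraph.edgeSet.ncard ≤ n - c := by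
    classical
    have : w.toSubgraph.edgeSet = (w.edges.toFinset : Set (Sym2 (Fin n))) := by
      ext e; simp
    rw [this, Set.ncard_coe_finset]
    refine (List.toFinset_card_le _).trans ?_
    simp [hw]
  refine le_trans (Nat.sInf_le ⟨w.toSubgraph, w.toSubgraph_connected, ?_, rfl⟩) hle
  intro v hv
  rw [Walk.mem_verts_toSubgraph]
  -- write v as point a + j with 1 ≤ j ≤ n
  have hex : ∃ j, 1 ≤ j ∧ j ≤ n ∧ cycPt n hn (a + j) = v := by
    have hv' := v.isLt
    have hm := Nat.mod_lt a (show n > 0 by omega)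
    have hda := Nat.div_add_mod a n
    by_cases hlt : a % n < v.val
    · refine ⟨v.val - a % n, by omega, by omega, Fin.ext ?_⟩
      simp only [cycPt]
      rw [show a + (v.val - a % n) = v.val + n * (a / n) by omega, Nat.add_mul_mod_self_left,
        Nat.mod_eq_of_lt hv']
    · refine ⟨v.val + n - a % n, by omega, by omega, Fin.ext ?_⟩
      simp only [cycPt]
      rw [show a + (v.val + n - a % n) = v.val + n + n * (a / n) by omega,
        Nat.add_mul_mod_self_left, Nat.add_mod_right, Nat.mod_eq_of_lt hv']
  obtain ⟨j, h1, h2, h3⟩ := hex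
  have hj : c ≤ j := by
    by_contra hlt
    exact ha j h1 (by omega) (h3 ▸ hv)
  have := hs (j - c) (by omega)
  rwa [show a + c + (j - c) = a + j by omega, h3] at this

lemma sub_verts_le {V : Type*} [Finite V] {G : SimpleGraph V} (H : G.Subgraph)
    (hH : H.Connected) : H.verts.ncard ≤ H.edgeSet.ncard + 1 := by
  have h1 := hH.coe.card_vert_le_card_edgeSet_add_one
  have h2 : Nat.card H.coe.edgeSet ≤ Nat.card H.edgeSet := by
    refine Nat.card_le_card_of_injective
      (fun e => ⟨Sym2.map Subtype.val e.1, ?_⟩) ?_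
    · obtain ⟨e, he⟩ := e
      induction e with
      | _ x y => simpa using he
    · intro e f hef
      have := congrArg Subtype.val hef
      exact Subtype.ext (Sym2.map.injective Subtype.val_injective this)
  rw [Nat.card_coe_set_eq, Nat.card_coe_set_eq] at h2
  rw [Nat.card_coe_set_eq, Nat.card_coe_set_eq] at h1
  omega

/-- A connected subgraph cannot separate two of its vertices. -/
lemma sub_closed {V : Type*} {G : SimpleGraph V} (H : G.Subgraph) (hH : H.Connected)
    (P : V → Prop) (hP : ∀ x y, H.Adj x y → P x → P y) {s t : V} (hs : s ∈ H.verts)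
    (ht : t ∈ H.verts) (h : P s) : P t := by
  obtain ⟨w⟩ := hH.coe.preconnected ⟨s, hs⟩ ⟨t, ht⟩
  have : ∀ (x y : H.verts) (w : H.coe.Walk x y), P x → P y := by
    intro x y w
    induction w with
    | nil => exact id
    | cons hadj _ ih => exact fun hx => ih (hP _ _ hadj hx)
  exact this _ _ w h

lemma cyc_lower {n c : ℕ} (hn : 3 ≤ n) (hc : 1 ≤ c) (S : Set (Fin n))
    (hS : ∀ i : Fin n, c ∣ i.val → i ∈ S) (H : (cycleGraph n).Subgraph) (hH : H.Connected)
    (hSH : S ⊆ H.verts) : n - c ≤ H.edgeSet.ncard := by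
  classical
  have h1 := sub_verts_le H hH
  set M : Finset (Fin n) := Finset.univ.filter (fun v => v ∉ H.verts) with hM
  have hcard : H.verts.ncard + M.card = n := by
    have h2 := Set.ncard_add_ncard_compl H.verts
    rw [Nat.card_fin] at h2
    rw [← Set.ncard_coe_finset M]
    have : (M : Set (Fin n)) = H.vertsᶜ := by ext; simp [hM]
    rw [this, h2]
  suffices M.card ≤ c - 1 by omega
  rcases M.eq_empty_or_nonempty with he | hne
  · simp [he]
  set u := M.min' hne
  set v := M.max' hne
  have hu : u ∉ H.verts := by have := M.min'_mem hne; simpa [hM] using this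
  have hv : v ∉ H.verts := by have := M.max'_mem hne; simpa [hM] using this
  have h0S : (⟨0, by omega⟩ : Fin n) ∈ H.verts := hSH (hS _ (dvd_zero _))
  have hu0 : 0 < u.val := by
    rcases Nat.eq_zero_or_pos u.val with h | h
    · exact absurd ((show u = ⟨0, by omega⟩ from Fin.ext h) ▸ h0S) hu
    · exact h
  have hMsub : M ⊆ Finset.Icc u v := fun x hx =>
    Finset.mem_Icc.2 ⟨M.min'_le x hx, M.le_max' x hx⟩
  have hMc := Finset.card_le_card hMsub
  rw [Fin.card_Icc] at hMc
  refine hMc.trans ?_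
  by_contra hcon
  -- a multiple of c in [u, v]
  have hdm := Nat.div_add_mod v.val c
  have hml := Nat.mod_lt v.val (show c > 0 by omega)
  have hvlt := v.isLt
  let s : Fin n := ⟨c * (v.val / c), by omega⟩
  have hs : s ∈ H.verts := hSH (hS s (dvd_mul_right _ _))
  have hsu : s ≠ u := fun h => hu (h ▸ hs)
  have hsv : s ≠ v := fun h => hv (h ▸ hs)
  have hsu' : s.val ≠ u.val := fun h => hsu (Fin.ext h)
  have hsv' : s.val ≠ v.val := fun h => hsv (Fin.ext h)
  have hsval : s.val = c * (v.val / c) := rfl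
  have := sub_closed H hH (fun x => u.val < x.val ∧ x.val < v.val) ?_ hs h0S
    ⟨by omega, by omega⟩
  · simp at this
  · intro x y hxy hx
    have hadj := (cyc_adj hn x y).1 hxy.adj_sub
    have hy := hxy.snd_mem
    have h3 : y.val ≠ u.val := fun h => hu ((Fin.ext h : y = u) ▸ hy)
    have h4 : y.val ≠ v.val := fun h => hv ((Fin.ext h : y = v) ▸ hy)
    have := y.isLt
    omega

/-- For `3 ≤ n` and `2 ≤ k ≤ n`, the Steiner `k`-diameter of the cycle `C_n`
is `⌊n(k-1)/k⌋`. -/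
theorem steinerDiam_cycleGraph (n k : ℕ) (hn : 3 ≤ n) (hk : 2 ≤ k) (hkn : k ≤ n) :
    steinerDiam (SimpleGraph.cycleGraph n) k = n * (k - 1) / k := by
  obtain ⟨q, hq⟩ : ∃ q, q = n * (k - 1) / k := ⟨_, rfl⟩
  have hq1 : k * q ≤ n * (k - 1) := hq ▸ Nat.mul_div_le _ _
  have hq2 : n * (k - 1) < k * (q + 1) := by
    rw [hq]; exact Nat.lt_mul_div_succ _ (by omega)
  obtain ⟨l, rfl⟩ : ∃ l, k = l + 1 := ⟨k - 1, by omega⟩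
  rw [← hq]
  simp only [Nat.add_sub_cancel] at hq1 hq2
  have hqn : q < n := by
    by_contra h
    have : (l + 1) * n ≤ (l + 1) * q := Nat.mul_le_mul_left _ (by omega)
    nlinarith
  obtain ⟨c, rfl⟩ : ∃ c, n = q + 1 + c := ⟨n - (q + 1), by omega⟩
  have hA : (l + 1) * c < q + 1 + c := by nlinarith
  have hB : q + 1 + c ≤ (l + 1) * (c + 1) := by nlinarith
  unfold steinerDiam
  apply le_antisymm
  · refine Finset.sup_le fun S hS => ?_
    have := cyc_upper (c := c + 1) hn (by omega) (by simpa using hA) S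
      (Finset.mem_powersetCard.1 hS).2
    omega
  · classical
    let T : Finset (Fin (q + 1 + c)) := Finset.univ.filter (fun i => (c + 1) ∣ i.val)
    have hT : T.card ≤ l + 1 := by
      have : T.card ≤ (Finset.range (l + 1)).card := by
        refine Finset.card_le_card_of_injOn (fun i => i.val / (c + 1)) ?_ ?_
        · intro i _
          have := i.isLt
          simp only [Finset.coe_range, Set.mem_Iio]
          exact Nat.div_lt_of_lt_mul (by nlinarith)
        · intro i hi j hj hij
          have h1 : (c + 1) ∣ i.val := by simpa [T] using hi
          have h2 : (c + 1) ∣ j.val := by simpa [T] using hj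
          apply Fin.ext
          rw [← Nat.div_mul_cancel h1, ← Nat.div_mul_cancel h2]
          simp only at hij
          rw [hij]
      simpa using this
    obtain ⟨S, hTS, hS⟩ := Finset.exists_superset_card_eq hT (by simpa using hkn)
    refine le_trans ?_ (Finset.le_sup (f := fun S : Finset (Fin (q + 1 + c)) =>
      steinerDist (cycleGraph (q + 1 + c)) (S : Set _))
      (Finset.mem_powersetCard.2 ⟨Finset.subset_univ S, hS⟩))
    have hne : {m | ∃ H : (cycleGraph (q + 1 + c)).Subgraph, H.Connected ∧
        (S : Set (Fin (q + 1 + c))) ⊆ H.verts ∧ H.edgeSet.ncard = m}.Nonempty := by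
      obtain ⟨b, w, hw, hs⟩ := cyc_walk hn (q + 1 + c) 0
      refine ⟨_, w.toSubgraph, w.toSubgraph_connected, ?_, rfl⟩
      intro v _
      rw [Walk.mem_verts_toSubgraph]
      have := hs v.val (by omega)
      convert this
      apply Fin.ext
      simp [cycPt, Nat.mod_eq_of_lt v.isLt]
    obtain ⟨H, hH, hSH, hm⟩ := Nat.sInf_mem hne
    have := cyc_lower (c := c + 1) hn (by omega) (S : Set _)
      (fun i hi => hTS (by simpa [T] using hi)) H hH hSH
    unfold steinerDist
    rw [← hm]
    omega
end

section
/- Let G be a connected simple graph of order n. Then sdiam_2(G) = 2 if and only if the complement of G has at least one edge and the complement of G does not contain a double star of order n as a subgraph. -/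
open SimpleGraph

/-- A graph `H` of order `n` contains a double star of order `n` as a subgraph:
there is an edge `uv` of `H` such that every other vertex is adjacent to `u` or to `v`
(such a double star is the union of stars centered at `u` and `v` containing `uv`,
and it spans all `n` vertices). -/
def ContainsSpanningDoubleStar {V : Type*} (H : SimpleGraph V) : Prop :=
  ∃ u v : V, H.Adj u v ∧ ∀ w : V, w ≠ u → w ≠ v → (H.Adj w u ∨ H.Adj w v)

theorem steinerDist_pair {V : Type*} [Fintype V]
    (G : SimpleGraph V) (hG : G.Connected) (u v : V) :
    steinerDist G {u, v} = G.dist u v := by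
  classical
  obtain ⟨p, hp⟩ := hG.exists_walk_length_eq_dist u v
  have hmem : p.toSubgraph.edgeSet.ncard ∈
      {m | ∃ H : G.Subgraph, H.Connected ∧ ({u, v} : Set V) ⊆ H.verts ∧
        H.edgeSet.ncard = m} := by
    refine ⟨p.toSubgraph, p.toSubgraph_connected, ?_, rfl⟩
    rintro x (rfl | rfl) <;> simp
  apply le_antisymm
  · refine (Nat.sInf_le hmem).trans ?_
    rw [← hp, ← p.length_edges]
    have : p.toSubgraph.edgeSet = (p.edges.toFinset : Set (Sym2 V)) := by
      ext e; simp
    rw [this, Set.ncard_coe_finset]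
    exact List.toFinset_card_le _
  · refine le_csInf ⟨_, hmem⟩ ?_
    rintro m ⟨H, hH, hS, rfl⟩
    obtain ⟨q, hq⟩ := ((Subgraph.connected_iff_forall_exists_walk_subgraph H).1 hH).2
      (hS (by simp : u ∈ _)) (hS (by simp : v ∈ _))
    refine (G.dist_le q.bypass).trans ?_
    rw [← Walk.length_edges, ← List.toFinset_card_of_nodup
      (q.bypass_isPath.isTrail.edges_nodup), ← Set.ncard_coe_finset]
    refine Set.ncard_le_ncard ?_ (Set.toFinite _)
    intro e he
    apply Subgraph.edgeSet_mono hq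
    rw [Walk.mem_edges_toSubgraph]
    exact q.edges_bypass_subset (by simpa using he)

theorem dist_le_two_iff_common {V : Type*} (G : SimpleGraph V) (hG : G.Connected) {u v : V}
    (huv : u ≠ v) (h : ¬ G.Adj u v) :
    G.dist u v ≤ 2 ↔ ∃ w, G.Adj u w ∧ G.Adj w v := by
  constructor
  · intro hd
    obtain ⟨p, hp⟩ := hG.exists_walk_length_eq_dist u v
    rw [← hp] at hd
    match p, hd with
    | .nil, _ => exact absurd rfl huv
    | .cons h1 .nil, _ => exact absurd h1 h
    | .cons h1 (.cons h2 .nil), _ => exact ⟨_, h1, h2⟩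
    | .cons h1 (.cons h2 (.cons h3 r)), hd => simp at hd
  · rintro ⟨w, h1, h2⟩
    exact G.dist_le (.cons h1 (.cons h2 .nil))

theorem steinerDiam_two_le_iff {V : Type*} [Fintype V] [DecidableEq V]
    (G : SimpleGraph V) (hG : G.Connected) (k : ℕ) :
    steinerDiam G 2 ≤ k ↔ ∀ u v : V, u ≠ v → G.dist u v ≤ k := by
  unfold steinerDiam
  rw [Finset.sup_le_iff]
  constructor
  · intro h u v huv
    have := h {u, v} (by simp [Finset.mem_powersetCard, Finset.card_pair huv])
    rw [← steinerDist_pair G hG]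
    simpa using this
  · intro h S hS
    obtain ⟨u, v, huv, rfl⟩ := Finset.card_eq_two.1 (Finset.mem_powersetCard.1 hS).2
    have := h u v huv
    rw [← steinerDist_pair G hG] at this
    simpa using this

/-- For a connected graph `G` of order `n`, `sdiam_2(G) = 2` iff the complement of `G`
is non-empty (has an edge) and the complement of `G` does not contain a double star of
order `n` as a subgraph. -/
theorem steinerDiam_two_eq_two_iff {V : Type*} [Fintype V] [DecidableEq V]
    (G : SimpleGraph V) (n : ℕ) (hn : Fintype.card V = n) (hG : G.Connected) :
    steinerDiam G 2 = 2 ↔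
      (∃ u v : V, Gᶜ.Adj u v) ∧ ¬ ContainsSpanningDoubleStar Gᶜ := by
  have h1 : steinerDiam G 2 ≤ 1 ↔ ¬ ∃ u v : V, Gᶜ.Adj u v := by
    rw [steinerDiam_two_le_iff G hG]
    push Not
    refine forall₂_congr fun u v => ?_
    rw [compl_adj]
    constructor
    · rintro h ⟨huv, hn⟩
      have h0 := hG.pos_dist_of_ne huv
      exact hn (dist_eq_one_iff_adj.1 (le_antisymm (h huv) h0))
    · intro h huv
      by_contra hd
      refine h ⟨huv, fun ha => hd ?_⟩
      rw [dist_eq_one_iff_adj.2 ha]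
  have h2 : steinerDiam G 2 ≤ 2 ↔ ¬ ContainsSpanningDoubleStar Gᶜ := by
    rw [steinerDiam_two_le_iff G hG]
    unfold ContainsSpanningDoubleStar
    push Not
    refine forall₂_congr fun u v => ?_
    simp only [compl_adj]
    constructor
    · rintro h ⟨huv, ha⟩
      obtain ⟨w, hu, hv⟩ := (dist_le_two_iff_common G hG huv ha).1 (h huv)
      exact ⟨w, hu.ne', hv.ne, fun h => h.2 hu.symm, fun h => h.2 hv⟩
    · intro h huv
      by_cases ha : G.Adj u v
      · rw [dist_eq_one_iff_adj.2 ha]; norm_num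
      · obtain ⟨w, a, b, c, d⟩ := h ⟨huv, ha⟩
        refine (dist_le_two_iff_common G hG huv ha).2 ⟨w, ?_, ?_⟩
        · by_contra hc; exact c ⟨a, fun h => hc h.symm⟩
        · by_contra hc; exact d ⟨b, hc⟩
  rw [← h2, ← not_iff_not.2 h1 |>.trans not_not]
  omega
end

section
/- Let G be a connected simple graph of order n ≥ 3. The following are equivalent: (i) sdiam_3(G) = 2; (ii) the maximum degree of the complement of G is at most 1; (iii) the minimum degree of G is at least n − 2. -/
open SimpleGraph

lemma sd_card_le {V : Type*} [Fintype V] {G : SimpleGraph V} (H : G.Subgraph)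
    (hH : H.Connected) : H.verts.ncard ≤ H.edgeSet.ncard + 1 := by
  have h := hH.coe.card_vert_le_card_edgeSet_add_one
  rw [← Subgraph.image_coe_edgeSet_coe, Set.ncard_image_of_injective _
    (Sym2.map.injective Subtype.val_injective)]
  exact h

lemma sd_spec {V : Type*} {G : SimpleGraph V} (hG : G.Connected) (S : Set V) :
    ∃ H : G.Subgraph, H.Connected ∧ S ⊆ H.verts ∧ H.edgeSet.ncard = steinerDist G S := by
  have hne : {m | ∃ H : G.Subgraph, H.Connected ∧ S ⊆ H.verts ∧ H.edgeSet.ncard = m}.Nonempty := by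
    refine ⟨_, ⊤, ?_, by simp, rfl⟩
    refine ⟨?_⟩
    exact (Subgraph.topIso.connected_iff).2 hG
  exact Nat.sInf_mem hne

lemma sd_ge {V : Type*} [Fintype V] {G : SimpleGraph V} (hG : G.Connected) (S : Finset V)
    (hS : S.card = 3) : 2 ≤ steinerDist G (S : Set V) := by
  obtain ⟨H, hH, hs, he⟩ := sd_spec hG (S : Set V)
  have h1 := sd_card_le H hH
  have h2 := Set.ncard_le_ncard hs (Set.toFinite _)
  rw [Set.ncard_coe_finset] at h2
  omega

lemma sd_le {V : Type*} {G : SimpleGraph V} {S : Set V} {a b c : V}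
    (hS : S ⊆ {a, b, c}) (hb : G.Adj a b) (hc : G.Adj a c) : steinerDist G S ≤ 2 := by
  have h : steinerDist G S ≤ (G.subgraphOfAdj hb ⊔ G.subgraphOfAdj hc).edgeSet.ncard := by
    refine Nat.sInf_le ⟨_, ?_, ?_, rfl⟩
    · refine Subgraph.connected_sup (Subgraph.subgraphOfAdj_connected hb).preconnected
        (Subgraph.subgraphOfAdj_connected hc).preconnected ⟨a, ?_⟩
      simp
    · intro x hx
      have := hS hx
      simp only [Set.mem_insert_iff, Set.mem_singleton_iff] at this
      simp only [Subgraph.verts_sup, subgraphOfAdj_verts, Set.mem_union, Set.mem_insert_iff,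
        Set.mem_singleton_iff]
      tauto
  refine h.trans ?_
  rw [Subgraph.edgeSet_sup, edgeSet_subgraphOfAdj, edgeSet_subgraphOfAdj]
  exact (Set.ncard_union_le _ _).trans (by simp)

lemma sd_main {V : Type*} [Fintype V] [DecidableEq V]
    (G : SimpleGraph V) (hn3 : 3 ≤ Fintype.card V) (hG : G.Connected) :
    steinerDiam G 3 = 2 ↔ ∀ v : V, (Gᶜ.neighborSet v).ncard ≤ 1 := by
  constructor
  · intro h v
    by_contra! hv
    obtain ⟨x, y, hx, hy, hxy⟩ := (Set.one_lt_ncard_iff (Set.toFinite _)).1 hv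
    simp only [mem_neighborSet, compl_adj] at hx hy
    have hcard : ({v, x, y} : Finset V).card = 3 := Finset.card_eq_three.2
      ⟨v, x, y, hx.1, hy.1, hxy, rfl⟩
    have hle : steinerDist G (({v, x, y} : Finset V) : Set V) ≤ 2 := by
      rw [← h]
      exact Finset.le_sup (f := fun S : Finset V => steinerDist G (S : Set V))
        (Finset.mem_powersetCard.2 ⟨Finset.subset_univ _, hcard⟩)
    obtain ⟨H, hH, hs, he⟩ := sd_spec hG (({v, x, y} : Finset V) : Set V)
    have h1 := sd_card_le H hH
    have heq : (({v, x, y} : Finset V) : Set V) = H.verts := by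
      refine Set.eq_of_subset_of_ncard_le hs ?_ (Set.toFinite _)
      rw [Set.ncard_coe_finset]
      omega
    have hvm : v ∈ H.verts := hs (by simp)
    have hxm : x ∈ H.verts := hs (by simp)
    haveI : Nontrivial H.verts := ⟨⟨v, hvm⟩, ⟨x, hxm⟩, by simpa using hx.1⟩
    obtain ⟨w, hw⟩ := hH.preconnected.exists_adj_of_nontrivial ⟨v, hvm⟩
    have hwm := H.edge_vert hw.symm
    rw [← heq] at hwm
    have hadj := hw.adj_sub
    simp only [Finset.coe_insert, Finset.coe_singleton, Set.mem_insert_iff,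
      Set.mem_singleton_iff] at hwm
    rcases hwm with rfl | rfl | rfl
    · exact hadj.ne rfl
    · exact hx.2 hadj
    · exact hy.2 hadj
  · intro h
    have key : ∀ v x y, v ≠ x → v ≠ y → x ≠ y → G.Adj v x ∨ G.Adj v y := by
      intro v x y hx hy hxy
      by_contra! hc
      exact hxy ((Set.ncard_le_one (Set.toFinite _)).1 (h v) x
        ((compl_adj ..).2 ⟨hx, hc.1⟩) y ((compl_adj ..).2 ⟨hy, hc.2⟩))
    apply le_antisymm
    · refine Finset.sup_le ?_
      intro S hS
      obtain ⟨a, b, c, hab, hac, hbc, rfl⟩ :=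
        Finset.card_eq_three.1 (Finset.mem_powersetCard.1 hS).2
      have k1 := key a b c hab hac hbc
      have k2 := key b a c hab.symm hbc hac
      have k3 := key c a b hac.symm hbc.symm hab
      have m1 : ((({a, b, c} : Finset V)) : Set V) ⊆ {a, b, c} := by simp
      have m2 : ((({a, b, c} : Finset V)) : Set V) ⊆ {b, a, c} := by
        intro z; simp; tauto
      have m3 : ((({a, b, c} : Finset V)) : Set V) ⊆ {c, a, b} := by
        intro z; simp; tauto
      by_cases p : G.Adj a b
      · by_cases q : G.Adj a c
        · exact sd_le m1 p q
        · exact sd_le m2 p.symm (k3.resolve_left fun e => q e.symm).symm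
      · exact sd_le m3 (k1.resolve_left p).symm (k2.resolve_left fun e => p e.symm).symm
    · obtain ⟨S, -, hS⟩ := Finset.exists_subset_card_eq
        (s := (Finset.univ : Finset V)) (by simpa using hn3)
      exact (sd_ge hG S hS).trans (Finset.le_sup (f := fun S : Finset V => steinerDist G (S : Set V))
        (Finset.mem_powersetCard.2 ⟨Finset.subset_univ _, hS⟩))

/-- For a connected graph `G` of order `n ≥ 3`, the following are equivalent:
`sdiam_3(G) = 2`; the maximum degree of the complement of `G` is at most `1`;
the minimum degree of `G` is at least `n - 2`. -/
theorem steinerDiam_three_eq_two_iff {V : Type*} [Fintype V] [DecidableEq V]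
    (G : SimpleGraph V) (n : ℕ) (hn : Fintype.card V = n) (hn3 : 3 ≤ n)
    (hG : G.Connected) :
    (steinerDiam G 3 = 2 ↔ ∀ v : V, (Gᶜ.neighborSet v).ncard ≤ 1) ∧
    (steinerDiam G 3 = 2 ↔ ∀ v : V, n - 2 ≤ (G.neighborSet v).ncard) := by
  subst hn
  refine ⟨sd_main G hn3 hG, (sd_main G hn3 hG).trans (forall_congr' fun v => ?_)⟩
  classical
  have h1 : (Gᶜ.neighborSet v).ncard = Gᶜ.degree v := by
    rw [← card_neighborSet_eq_degree, Set.ncard_eq_toFinset_card', Set.toFinset_card]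
  have h2 : (G.neighborSet v).ncard = G.degree v := by
    rw [← card_neighborSet_eq_degree, Set.ncard_eq_toFinset_card', Set.toFinset_card]
  have h3 := G.degree_compl (v := v)
  have h4 := G.degree_lt_card_verts v
  omega
end

section
/- Let G be a connected simple graph of order n ≥ 3. Then sdiam_3(G) = 3 if and only if all three of the following hold: (i) the maximum degree of the complement of G is at least 2; (ii) the complement of G does not contain a triple-star of order n as a subgraph; (iii) the complement of G does not contain a graph H_2 of order n as a subgraph. -/
open SimpleGraph

/-- A graph `H` of order `n` contains a triple-star of order `n` as a subgraph:
there is a triangle `u, v, w` in `H`, at least one vertex outside the triangle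
(the triple-star has `c ≥ 1` pendant vertices at one center), and every vertex outside
the triangle is adjacent to `u`, `v` or `w`. -/
def ContainsSpanningTripleStar {V : Type*} (H : SimpleGraph V) : Prop :=
  ∃ u v w : V, u ≠ v ∧ u ≠ w ∧ v ≠ w ∧ H.Adj u v ∧ H.Adj u w ∧ H.Adj v w ∧
    (∃ x : V, x ≠ u ∧ x ≠ v ∧ x ≠ w) ∧
    (∀ x : V, x ≠ u → x ≠ v → x ≠ w → (H.Adj x u ∨ H.Adj x v ∨ H.Adj x w))

/-- A graph `H` of order `n` contains the graph `H₂` of order `n` as a subgraph: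
there is a path `u, v, w` in `H`, and every vertex `x` outside `{u, v, w}` is joined in `H`
to all of `u, v, w`, or to `u` and `v`, or to `v` and `w`, or to `u` and `w`, or to `v`. -/
def ContainsSpanningH2 {V : Type*} (H : SimpleGraph V) : Prop :=
  ∃ u v w : V, u ≠ v ∧ u ≠ w ∧ v ≠ w ∧ H.Adj u v ∧ H.Adj v w ∧
    (∀ x : V, x ≠ u → x ≠ v → x ≠ w →
      ((H.Adj x u ∧ H.Adj x v ∧ H.Adj x w) ∨ (H.Adj x u ∧ H.Adj x v) ∨
       (H.Adj x v ∧ H.Adj x w) ∨ (H.Adj x u ∧ H.Adj x w) ∨ H.Adj x v))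

lemma st_insert_conn {V : Type*} {G : SimpleGraph V} {T : Set V} {a x : V}
    (hT : (G.induce T).Connected) (ha : a ∈ T) (hax : G.Adj a x) :
    (G.induce (insert x T)).Connected := by
  have h := induce_union_connected (G := G) (s := T) (t := {a, x}) hT.preconnected
    (induce_pair_connected_of_adj hax).preconnected ⟨a, ha, by simp⟩
  have e : T ∪ {a, x} = insert x T := by
    ext y; simp only [Set.mem_union, Set.mem_insert_iff, Set.mem_singleton_iff]
    constructor
    · rintro (h | rfl | h) <;> simp_all
    · rintro (h | h) <;> simp_all
  rw [e] at h
  exact h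

lemma st_single_conn {V : Type*} {G : SimpleGraph V} (a : V) :
    (G.induce ({a} : Set V)).Connected := by
  refine (connected_iff_exists_forall_reachable _).2 ⟨⟨a, rfl⟩, ?_⟩
  rintro ⟨b, hb⟩
  obtain rfl : b = a := hb
  exact Reachable.refl _

lemma st_cut {V : Type*} {G : SimpleGraph V} {T : Set V}
    (hT : (G.induce T).Connected) (A : Set V) {a b : V} (ha : a ∈ T) (haA : a ∈ A)
    (hb : b ∈ T) (hbA : b ∉ A) :
    ∃ x ∈ T, ∃ y ∈ T, x ∈ A ∧ y ∉ A ∧ G.Adj x y := by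
  obtain ⟨p⟩ := hT.preconnected ⟨a, ha⟩ ⟨b, hb⟩
  obtain ⟨d, -, h1, h2⟩ := p.exists_boundary_dart (Subtype.val ⁻¹' A) haA hbA
  exact ⟨d.fst, d.fst.2, d.snd, d.snd.2, h1, h2, d.adj⟩

lemma st_dist_le {V : Type*} [Fintype V] (G : SimpleGraph V) (hG : G.Connected)
    (S : Set V) (m : ℕ) :
    steinerDist G S ≤ m ↔ ∃ T : Set V, S ⊆ T ∧ T.ncard ≤ m + 1 ∧ (G.induce T).Connected := by
  classical
  constructor
  · intro h
    have hne : {m | ∃ H : G.Subgraph, H.Connected ∧ S ⊆ H.verts ∧ H.edgeSet.ncard = m}.Nonempty :=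
      ⟨_, ⊤, Subgraph.connected_iff'.2 (by
        exact (Subgraph.topIso (G := G)).connected_iff.2 hG), by simp, rfl⟩
    obtain ⟨H, hc, hS, hm⟩ := Nat.sInf_mem hne
    refine ⟨H.verts, hS, ?_, ?_⟩
    · have h1 := (Subgraph.connected_iff'.1 hc).card_vert_le_card_edgeSet_add_one
      rw [Nat.card_coe_set_eq, Nat.card_coe_set_eq] at h1
      have h2 : H.coe.edgeSet.ncard ≤ H.edgeSet.ncard := by
        apply Set.ncard_le_ncard_of_injOn (Sym2.map Subtype.val)
        · intro e he
          induction e using Sym2.ind with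
          | _ x y => simpa using he
        · exact (Sym2.map.injective Subtype.val_injective).injOn
      have : H.edgeSet.ncard ≤ m := by rw [hm]; exact h
      omega
    · refine (Subgraph.connected_iff'.1 hc).mono ?_
      intro x y hxy
      exact H.adj_sub hxy
  · rintro ⟨T, hST, hcard, hc⟩
    obtain ⟨F, hF, hFt⟩ := hc.exists_isTree_le
    let H : G.Subgraph :=
      { verts := T
        Adj := fun a b => ∃ (ha : a ∈ T) (hb : b ∈ T), F.Adj ⟨a, ha⟩ ⟨b, hb⟩
        adj_sub := by rintro a b ⟨ha, hb, h⟩; exact hF h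
        edge_vert := by rintro a b ⟨ha, hb, h⟩; exact ha
        symm := ⟨by rintro a b ⟨ha, hb, h⟩; exact ⟨hb, ha, h.symm⟩⟩ }
    have hHc : H.Connected := by
      refine Subgraph.connected_iff'.2 ((hFt.connected).mono ?_)
      intro x y hxy
      exact ⟨x.2, y.2, hxy⟩
    have h1 : H.edgeSet ⊆ (Sym2.map Subtype.val) '' F.edgeSet := by
      intro e he
      induction e using Sym2.ind with
      | _ x y =>
        obtain ⟨ha, hb, h⟩ : ∃ (ha : x ∈ T) (hb : y ∈ T), F.Adj ⟨x, ha⟩ ⟨y, hb⟩ := he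
        exact ⟨s(⟨x, ha⟩, ⟨y, hb⟩), h, rfl⟩
    have h2 : H.edgeSet.ncard ≤ F.edgeSet.ncard :=
      (Set.ncard_le_ncard h1 (Set.toFinite _)).trans (Set.ncard_image_le (Set.toFinite _))
    have h3 := hFt.card_edgeFinset
    rw [← Nat.card_eq_fintype_card, Nat.card_coe_set_eq] at h3
    rw [Set.ncard_eq_toFinset_card' F.edgeSet] at h2
    have h4 : F.edgeFinset.card = F.edgeSet.toFinset.card := rfl
    have h5 : steinerDist G S ≤ H.edgeSet.ncard := Nat.sInf_le ⟨H, hHc, hST, rfl⟩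
    omega

lemma st_diam_le {V : Type*} [Fintype V] [DecidableEq V] (G : SimpleGraph V) (hG : G.Connected)
    (m : ℕ) : steinerDiam G 3 ≤ m ↔ ∀ u v w : V, u ≠ v → u ≠ w → v ≠ w →
      ∃ T : Set V, ({u, v, w} : Set V) ⊆ T ∧ T.ncard ≤ m + 1 ∧ (G.induce T).Connected := by
  unfold steinerDiam
  rw [Finset.sup_le_iff]
  constructor
  · intro h u v w huv huw hvw
    have := h {u, v, w} (by
      rw [Finset.mem_powersetCard]
      exact ⟨Finset.subset_univ _, Finset.card_eq_three.2 ⟨u, v, w, huv, huw, hvw, rfl⟩⟩)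
    rw [st_dist_le G hG] at this
    simpa using this
  · intro h S hS
    obtain ⟨u, v, w, huv, huw, hvw, rfl⟩ := Finset.card_eq_three.1 (Finset.mem_powersetCard.1 hS).2
    rw [st_dist_le G hG]
    simpa using h u v w huv huw hvw

lemma st_two {V : Type*} [Fintype V] [DecidableEq V] (G : SimpleGraph V) (hG : G.Connected) :
    steinerDiam G 3 ≤ 2 ↔ ¬ ∃ v : V, 2 ≤ (Gᶜ.neighborSet v).ncard := by
  rw [st_diam_le G hG]
  constructor
  · rintro h ⟨v, hv⟩
    obtain ⟨u, w, hu, hw, huw⟩ := (Set.one_lt_ncard_iff (Set.toFinite _)).1 hv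
    simp only [mem_neighborSet, compl_adj] at hu hw
    obtain ⟨T, hST, hT, hc⟩ := h u v w hu.1.symm huw hw.1
    have hS3 : ({u, v, w} : Set V).ncard = 3 :=
      Set.ncard_eq_three.2 ⟨u, v, w, hu.1.symm, huw, hw.1, rfl⟩
    obtain rfl := Set.eq_of_subset_of_ncard_le hST (by omega) (Set.toFinite _)
    obtain ⟨x, hx, y, hy, hxv, hyv, hxy⟩ := st_cut hc {v} (a := v) (b := u)
      (by simp) rfl (by simp) (by simpa using hu.1.symm)
    simp only [Set.mem_insert_iff, Set.mem_singleton_iff] at *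
    subst hxv
    rcases hy with rfl | rfl | rfl
    · exact hu.2 hxy
    · exact hyv rfl
    · exact hw.2 hxy
  · intro h u v w huv huw hvw
    refine ⟨{u, v, w}, subset_rfl, ?_, ?_⟩
    · exact (Set.ncard_eq_three.2 ⟨u, v, w, huv, huw, hvw, rfl⟩).le
    · have key : ∀ a b c : V, a ≠ b → a ≠ c → b ≠ c → G.Adj a b ∨ G.Adj a c := by
        intro a b c hab hac hbc
        by_contra hcon
        push Not at hcon
        exact h ⟨a, (Set.one_lt_ncard_iff (Set.toFinite _)).2
          ⟨b, c, by simp [hab, hcon.1], by simp [hac, hcon.2], hbc⟩⟩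
      have key2 : ∀ a b c : V, G.Adj a b → G.Adj a c → (G.induce ({b, c, a} : Set V)).Connected := by
        intro a b c hab hac
        exact st_insert_conn (a := a) (st_insert_conn (st_single_conn a) rfl hac) (by simp) hab
      have e1 : ({u, v, w} : Set V) = {u, w, v} := by ext; simp; tauto
      have e2 : ({u, v, w} : Set V) = {v, w, u} := by ext; simp; tauto
      have k1 := key u v w huv huw hvw
      have k2 := key v u w huv.symm hvw huw
      have k3 := key w u v huw.symm hvw.symm huv
      by_cases c1 : G.Adj u v
      · by_cases c2 : G.Adj u w
        · rw [e2]; exact key2 _ _ _ c1 c2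
        · rw [e1]; exact key2 _ _ _ c1.symm ((k3.resolve_left fun h => c2 h.symm).symm)
      · have c2 := k1.resolve_left c1
        have c3 := k2.resolve_left fun h => c1 h.symm
        exact key2 _ _ _ c2.symm c3.symm

lemma st_three {V : Type*} [Fintype V] [DecidableEq V] (G : SimpleGraph V) (hG : G.Connected) :
    steinerDiam G 3 ≤ 3 ↔ ¬ ContainsSpanningTripleStar Gᶜ ∧ ¬ ContainsSpanningH2 Gᶜ := by
  rw [st_diam_le G hG]
  have hform : ∀ u v w : V, u ≠ v → u ≠ w → v ≠ w → ∀ T : Set V, ({u, v, w} : Set V) ⊆ T →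
      T.ncard ≤ 3 + 1 → T = {u, v, w} ∨ ∃ x, x ≠ u ∧ x ≠ v ∧ x ≠ w ∧ T = {x, u, v, w} := by
    intro u v w huv huw hvw T hST hT
    have hS3 : ({u, v, w} : Set V).ncard = 3 :=
      Set.ncard_eq_three.2 ⟨u, v, w, huv, huw, hvw, rfl⟩
    by_cases hx : ∃ x ∈ T, x ∉ ({u, v, w} : Set V)
    · right
      obtain ⟨x, hxT, hx⟩ := hx
      have h4 := Set.ncard_insert_of_notMem hx (Set.toFinite _)
      have := Set.eq_of_subset_of_ncard_le (Set.insert_subset hxT hST) (by omega) (Set.toFinite _)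
      simp only [Set.mem_insert_iff, Set.mem_singleton_iff, not_or] at hx
      exact ⟨x, hx.1, hx.2.1, hx.2.2, this.symm⟩
    · left
      push Not at hx
      exact Set.Subset.antisymm hx hST
  constructor
  · intro h
    constructor
    · rintro ⟨u, v, w, huv, huw, hvw, h1, h2, h3, -, hall⟩
      obtain ⟨T, hST, hT, hc⟩ := h u v w huv huw hvw
      have cutu := st_cut hc {u} (a := u) (b := v) (hST (by simp)) rfl (hST (by simp)) (by simp [huv.symm])
      have cutv := st_cut hc {v} (a := v) (b := u) (hST (by simp)) rfl (hST (by simp)) (by simp [huv])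
      have cutw := st_cut hc {w} (a := w) (b := u) (hST (by simp)) rfl (hST (by simp)) (by simp [huw])
      simp only [compl_adj] at h1 h2 h3 hall
      have s1 := G.adj_comm u v
      have s2 := G.adj_comm u w
      have s3 := G.adj_comm v w
      rcases hform u v w huv huw hvw T hST hT with rfl | ⟨x, hxu, hxv, hxw, rfl⟩
      · simp at cutu cutv cutw
        grind
      · have := hall x hxu hxv hxw
        have s4 := G.adj_comm x u
        have s5 := G.adj_comm x v
        have s6 := G.adj_comm x w
        simp at cutu cutv cutw
        grind
    · rintro ⟨u, v, w, huv, huw, hvw, h1, h3, hall⟩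
      obtain ⟨T, hST, hT, hc⟩ := h u v w huv huw hvw
      have cutv := st_cut hc {v} (a := v) (b := u) (hST (by simp)) rfl (hST (by simp)) (by simp [huv])
      simp only [compl_adj] at h1 h3 hall
      have s1 := G.adj_comm u v
      have s3 := G.adj_comm v w
      rcases hform u v w huv huw hvw T hST hT with rfl | ⟨x, hxu, hxv, hxw, rfl⟩
      · simp at cutv
        grind
      · have := hall x hxu hxv hxw
        have cutx := st_cut hc {x, v} (a := v) (b := u) (hST (by simp)) (by simp) (hST (by simp))
          (by simp [huv, hxu.symm])
        have s4 := G.adj_comm x u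
        have s5 := G.adj_comm x v
        have s6 := G.adj_comm x w
        simp at cutv cutx
        grind
  · rintro ⟨hA, hB⟩ u v w huv huw hvw
    -- the case where `v` is the vertex isolated in `G[S]`, or `G[S]` has an edge
    have key : ∀ u v w : V, u ≠ v → u ≠ w → v ≠ w → G.Adj u w →
        ∃ T : Set V, ({u, v, w} : Set V) ⊆ T ∧ T.ncard ≤ 3 + 1 ∧ (G.induce T).Connected := by
      intro u v w huv huw hvw h
      have c3 : ({u, v, w} : Set V).ncard = 3 := Set.ncard_eq_three.2 ⟨u, v, w, huv, huw, hvw, rfl⟩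
      have e : ({u, v, w} : Set V) = {v, u, w} := by ext; simp; tauto
      have cuw : (G.induce ({u, w} : Set V)).Connected := induce_pair_connected_of_adj h
      by_cases a1 : G.Adj u v
      · exact ⟨{u, v, w}, subset_rfl, by omega, e ▸ st_insert_conn (a := u) cuw (by simp) a1⟩
      by_cases a2 : G.Adj w v
      · exact ⟨{u, v, w}, subset_rfl, by omega, e ▸ st_insert_conn (a := w) cuw (by simp) a2⟩
      have : ∃ x, x ≠ u ∧ x ≠ v ∧ x ≠ w ∧ G.Adj x v ∧ (G.Adj x u ∨ G.Adj x w) := by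
        by_contra hcon
        push Not at hcon
        refine hB ⟨u, v, w, huv, huw, hvw, by simp [huv, a1], by simp [hvw, G.adj_comm v w, a2], ?_⟩
        intro x hxu hxv hxw
        have := hcon x hxu hxv hxw
        simp only [compl_adj]
        tauto
      obtain ⟨x, hxu, hxv, hxw, hv, h'⟩ := this
      refine ⟨{v, x, u, w}, by rw [e]; intro y; simp; tauto, ?_, ?_⟩
      · have h1 := Set.ncard_insert_le v {x, u, w}
        have h2 := Set.ncard_insert_le x {u, w}
        have h3 := Set.ncard_insert_le u {w}
        have h4 := Set.ncard_singleton w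
        omega
      · refine st_insert_conn (a := x) ?_ (by simp) hv
        rcases h' with h' | h'
        · exact st_insert_conn (a := u) cuw (by simp) h'.symm
        · exact st_insert_conn (a := w) cuw (by simp) h'.symm
    by_cases a1 : G.Adj u w
    · exact key u v w huv huw hvw a1
    by_cases a2 : G.Adj u v
    · have e : ({u, v, w} : Set V) = {u, w, v} := by ext; simp; tauto
      rw [e]; exact key u w v huw huv hvw.symm a2
    by_cases a3 : G.Adj v w
    · have e : ({u, v, w} : Set V) = {v, u, w} := by ext; simp; tauto
      rw [e]; exact key v u w huv.symm hvw huw a3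
    have hex : ∃ x, x ≠ u ∧ x ≠ v ∧ x ≠ w := by
      by_contra hcon
      push Not at hcon
      obtain ⟨p⟩ := hG.preconnected u v
      obtain ⟨d, -, h1, h2⟩ := p.exists_boundary_dart {u} rfl (by simpa using huv.symm)
      have h3 := d.adj
      obtain h1 : d.fst = u := h1
      have h2 : d.snd ≠ u := h2
      rw [h1] at h3
      by_cases h4 : d.snd = v
      · exact a2 (h4 ▸ h3)
      · exact a1 (hcon _ h2 h4 ▸ h3)
    have : ∃ x, G.Adj x u ∧ G.Adj x v ∧ G.Adj x w := by
      by_contra hcon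
      push Not at hcon
      refine hA ⟨u, v, w, huv, huw, hvw, by simp [huv, a2], by simp [huw, a1], by simp [hvw, a3],
        hex, ?_⟩
      intro x hxu hxv hxw
      have := hcon x
      simp only [compl_adj]
      tauto
    obtain ⟨x, xu, xv, xw⟩ := this
    refine ⟨{u, v, w, x}, by intro y; simp; tauto, ?_, ?_⟩
    · have h1 := Set.ncard_insert_le u {v, w, x}
      have h2 := Set.ncard_insert_le v {w, x}
      have h3 := Set.ncard_insert_le w {x}
      have h4 := Set.ncard_singleton x
      omega
    · exact st_insert_conn (a := x) (st_insert_conn (a := x)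
        (st_insert_conn (st_single_conn x) rfl xw) (by simp) xv) (by simp) xu

/-- For a connected graph `G` of order `n ≥ 3`, `sdiam_3(G) = 3` iff the complement has
maximum degree at least `2`, does not contain a triple-star of order `n` as a subgraph,
and does not contain `H₂` (of order `n`) as a subgraph. -/
theorem steinerDiam_three_eq_three_iff {V : Type*} [Fintype V] [DecidableEq V]
    (G : SimpleGraph V) (n : ℕ) (hn : Fintype.card V = n) (hn3 : 3 ≤ n)
    (hG : G.Connected) :
    steinerDiam G 3 = 3 ↔
      (∃ v : V, 2 ≤ (Gᶜ.neighborSet v).ncard) ∧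
      ¬ ContainsSpanningTripleStar Gᶜ ∧ ¬ ContainsSpanningH2 Gᶜ := by
  rw [← st_three G hG]
  have h := st_two G hG
  constructor
  · intro h3
    exact ⟨by by_contra hc; have := h.2 hc; omega, by omega⟩
  · rintro ⟨h1, h2⟩
    have : ¬ steinerDiam G 3 ≤ 2 := fun hh => h.1 hh h1
    omega
end

section
/- Let G be a connected simple graph of order n ≥ 3. Then sdiam_3(G) = n − 1 if and only if either G is a tree of the form T_{a,b,c} with a ≥ 0, 1 ≤ b ≤ c and a + b + c = n − 1, or G is a unicyclic graph of the form △_{p,q,r} with 0 ≤ p ≤ q ≤ r and p + q + r = n − 3. -/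
open SimpleGraph

/-- `G` is a tree of the form `T_{a,b,c}` (a spider with legs of `a`, `b`, `c` vertices,
`a ≥ 0`, `1 ≤ b ≤ c`, `a + b + c = n - 1`): equivalently, `G` is a tree with at most
three leaves. -/
def IsSpiderTree {V : Type*} (G : SimpleGraph V) : Prop :=
  G.IsTree ∧ {v : V | (G.neighborSet v).ncard = 1}.ncard ≤ 3

/-- `G` is a unicyclic graph of the form `△_{p,q,r}`: a triangle with three
vertex-disjoint paths of `p`, `q`, `r` vertices (`p + q + r = n - 3`) attached by an
edge to the three triangle vertices. Equivalently, `G` is connected, has exactly `n`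
edges (unicyclic), contains a triangle `u, v, w`, every vertex outside the triangle
has degree at most `2`, and the triangle vertices have degree at most `3`. -/
def IsTriangleWithPaths {V : Type*} [Fintype V] (G : SimpleGraph V) : Prop :=
  G.Connected ∧ G.edgeSet.ncard = Fintype.card V ∧
    ∃ u v w : V, u ≠ v ∧ u ≠ w ∧ v ≠ w ∧ G.Adj u v ∧ G.Adj u w ∧ G.Adj v w ∧
      (G.neighborSet u).ncard ≤ 3 ∧ (G.neighborSet v).ncard ≤ 3 ∧
      (G.neighborSet w).ncard ≤ 3 ∧
      (∀ x : V, x ≠ u → x ≠ v → x ≠ w → (G.neighborSet x).ncard ≤ 2)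

section SteinerHelpers

variable {V : Type*}

lemma reachable_of_adj_reachable {H K : SimpleGraph V}
    (h : ∀ a b, H.Adj a b → K.Reachable a b) {a b : V} (hab : H.Reachable a b) :
    K.Reachable a b := by
  obtain ⟨p⟩ := hab
  induction p with
  | nil => exact Reachable.refl _
  | cons hadj _ ih => exact (h _ _ hadj).trans ih

lemma connected_of_adj_reachable {H K : SimpleGraph V}
    (h : ∀ a b, H.Adj a b → K.Reachable a b) (hH : H.Connected) : K.Connected :=
  (connected_iff _).2 ⟨fun a b => reachable_of_adj_reachable h (hH.preconnected a b), hH.nonempty⟩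

lemma sum_dg [Fintype V] (G : SimpleGraph V) :
    ∑ x, (G.neighborSet x).ncard = 2 * G.edgeSet.ncard := by
  classical
  have h := G.sum_degrees_eq_twice_card_edges
  rw [← coe_edgeFinset, Set.ncard_coe_finset, ← h]
  refine Finset.sum_congr rfl fun x _ => ?_
  rw [← G.card_neighborSet_eq_degree, Set.ncard_eq_toFinset_card', Set.toFinset_card]

lemma dg_add [Fintype V] [DecidableEq V] {H : SimpleGraph V} {p q : V} (hpq : p ≠ q)
    (hn : ¬ H.Adj p q) (x : V) :
    ((H ⊔ edge p q).neighborSet x).ncard =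
      (H.neighborSet x).ncard + if x = p ∨ x = q then 1 else 0 := by
  have hn' : ¬ H.Adj q p := fun h => hn h.symm
  by_cases hp : x = p
  · subst hp
    have : (H ⊔ edge x q).neighborSet x = insert q (H.neighborSet x) := by
      ext y; simp [edge_adj]; grind
    rw [this, Set.ncard_insert_of_notMem (by simpa using hn) (Set.toFinite _)]
    simp
  · by_cases hq : x = q
    · subst hq
      have : (H ⊔ edge p x).neighborSet x = insert p (H.neighborSet x) := by
        ext y; simp [edge_adj]; grind
      rw [this, Set.ncard_insert_of_notMem (by simpa using hn') (Set.toFinite _)]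
      simp
    · have : (H ⊔ edge p q).neighborSet x = H.neighborSet x := by
        ext y; simp [edge_adj]; grind
      simp [this, hp, hq]

lemma edges_add [Fintype V] {H : SimpleGraph V} {p q : V} (hpq : p ≠ q)
    (hn : ¬ H.Adj p q) : (H ⊔ edge p q).edgeSet.ncard = H.edgeSet.ncard + 1 := by
  have : (H ⊔ edge p q).edgeSet = insert s(p, q) H.edgeSet := by
    ext ⟨a, b⟩
    simp [edge_adj]
    grind
  rw [this, Set.ncard_insert_of_notMem (by simpa using hn) (Set.toFinite _)]

lemma del_add {H : SimpleGraph V} {p q : V} (h : H.Adj p q) :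
    H.deleteEdges {s(p, q)} ⊔ edge p q = H := by
  ext a b
  simp [edge_adj]
  grind [h.symm, h.ne]

lemma not_adj_del {H : SimpleGraph V} {p q : V} : ¬ (H.deleteEdges {s(p, q)}).Adj p q := by
  simp

lemma dg_del [Fintype V] [DecidableEq V] {H : SimpleGraph V} {p q : V} (h : H.Adj p q) (x : V) :
    (H.neighborSet x).ncard =
      ((H.deleteEdges {s(p, q)}).neighborSet x).ncard + if x = p ∨ x = q then 1 else 0 := by
  rw [← dg_add h.ne not_adj_del, del_add h]

lemma edges_del [Fintype V] {H : SimpleGraph V} {p q : V} (h : H.Adj p q) :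
    H.edgeSet.ncard = (H.deleteEdges {s(p, q)}).edgeSet.ncard + 1 := by
  rw [← edges_add h.ne not_adj_del, del_add h]

lemma dg_pos [Fintype V] {H : SimpleGraph V} (hH : H.Connected) (hV : 2 ≤ Fintype.card V)
    (x : V) : 1 ≤ (H.neighborSet x).ncard := by
  have : Nontrivial V := Fintype.one_lt_card_iff_nontrivial.1 hV
  obtain ⟨y, hy⟩ := hH.preconnected.exists_adj_of_nontrivial x
  exact (Set.ncard_pos (Set.toFinite _)).2 ⟨y, hy⟩

lemma steinerDist_lt_of_induce [Fintype V] {G : SimpleGraph V} {S W : Set V}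
    (hW : (G.induce W).Connected) (hS : S ⊆ W) : steinerDist G S + 1 ≤ W.ncard := by
  obtain ⟨T, hle, hT⟩ := hW.exists_isTree_le
  let K : G.Subgraph :=
    { verts := W
      Adj := fun a b => ∃ (ha : a ∈ W) (hb : b ∈ W), T.Adj ⟨a, ha⟩ ⟨b, hb⟩
      adj_sub := by
        rintro a b ⟨ha, hb, h⟩
        exact hle h
      edge_vert := fun ⟨ha, _⟩ => ha
      symm := ⟨fun a b ⟨ha, hb, h⟩ => ⟨hb, ha, h.symm⟩⟩ }
  have hK : K.coe = T := by
    ext a b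
    simp [K]
  have hKc : K.Connected := ⟨by rw [hK]; exact hT.connected⟩
  have hE : K.edgeSet = Sym2.map Subtype.val '' T.edgeSet := by
    ext e
    induction e with | _ a b
    constructor
    · rintro ⟨ha, hb, h⟩
      exact ⟨s(⟨a, ha⟩, ⟨b, hb⟩), h, rfl⟩
    · rintro ⟨e', he', h⟩
      induction e' with | _ c d
      rw [← h]
      exact ⟨c.2, d.2, he'⟩
  have hcard := (isTree_iff_connected_and_card.1 hT).2
  have h1 : steinerDist G S ≤ K.edgeSet.ncard := Nat.sInf_le ⟨K, hKc, hS, rfl⟩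
  rw [hE, Set.ncard_image_of_injective _ (Sym2.map.injective Subtype.val_injective)] at h1
  rw [Nat.card_coe_set_eq, Nat.card_coe_set_eq] at hcard
  omega

lemma steinerDist_lt_card [Fintype V] {G : SimpleGraph V} (hG : G.Connected) (S : Set V) :
    steinerDist G S + 1 ≤ Fintype.card V := by
  have h : (G.induce Set.univ).Connected := (induceUnivIso G).connected_iff.2 hG
  have := steinerDist_lt_of_induce h (Set.subset_univ S)
  rwa [Set.ncard_univ, Nat.card_eq_fintype_card] at this

lemma le_steinerDist [Fintype V] {G : SimpleGraph V} (hG : G.Connected) {S : Set V}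
    (h : ∀ W : Set V, S ⊆ W → (G.induce W).Connected → W = Set.univ) :
    Fintype.card V ≤ steinerDist G S + 1 := by
  have hne : {m | ∃ H : G.Subgraph, H.Connected ∧ S ⊆ H.verts ∧ H.edgeSet.ncard = m}.Nonempty := by
    refine ⟨_, toSubgraph G le_rfl, hG.toSubgraph le_rfl, ?_, rfl⟩
    simp
  obtain ⟨H, hH, hS, hm⟩ := Nat.sInf_mem hne
  have hv := h H.verts hS hH.induce_verts
  have h1 := hH.coe.card_vert_le_card_edgeSet_add_one
  have h2 : Nat.card H.coe.edgeSet ≤ H.edgeSet.ncard := by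
    rw [Nat.card_coe_set_eq, ← Set.ncard_image_of_injective _
      (Sym2.map.injective (Subtype.val_injective (p := fun x => x ∈ H.verts)))]
    refine Set.ncard_le_ncard ?_ (Set.toFinite _)
    rintro _ ⟨e, he, rfl⟩
    induction e with | _ c d
    exact he
  have h3 : Nat.card H.verts = Fintype.card V := by
    rw [Nat.card_coe_set_eq, hv, Set.ncard_univ, Nat.card_eq_fintype_card]
  unfold steinerDist
  omega

/-- In a tree, a connected vertex set outside of which all degrees are at least two is everything. -/
lemma tree_connected_set_univ [Fintype V] {G : SimpleGraph V} (hG : G.Connected)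
    (hE : G.edgeSet.ncard + 1 = Fintype.card V) {W : Set V} (hW : (G.induce W).Connected)
    (hd : ∀ x, x ∉ W → 2 ≤ (G.neighborSet x).ncard) : W = Set.univ := by
  classical
  set E : Set (Sym2 V) := Sym2.map Subtype.val '' (G.induce W).edgeSet with hEdef
  have hEW : ∀ a b, s(a, b) ∈ E ↔ a ∈ W ∧ b ∈ W ∧ G.Adj a b := by
    intro a b
    constructor
    · rintro ⟨e, he, h⟩
      induction e with | _ c d
      have hcd : G.Adj c d := he
      simp only [Sym2.map_mk, Sym2.eq_iff] at h
      rcases h with ⟨rfl, rfl⟩ | ⟨rfl, rfl⟩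
      · exact ⟨c.2, d.2, hcd⟩
      · exact ⟨d.2, c.2, hcd.symm⟩
    · rintro ⟨ha, hb, h⟩
      exact ⟨s(⟨a, ha⟩, ⟨b, hb⟩), h, rfl⟩
  have h1 := hW.card_vert_le_card_edgeSet_add_one
  rw [Nat.card_coe_set_eq, Nat.card_coe_set_eq, ← Set.ncard_image_of_injective _
      (Sym2.map.injective (Subtype.val_injective (p := fun x => x ∈ W)))] at h1
  change W.ncard ≤ E.ncard + 1 at h1
  have hsub : E ⊆ G.edgeSet := by
    intro e he
    induction e with | _ a b
    exact ((hEW a b).1 he).2.2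
  have h2 : (G.deleteEdges E).edgeSet.ncard + E.ncard = G.edgeSet.ncard := by
    rw [edgeSet_deleteEdges]
    exact Set.ncard_sdiff_add_ncard_of_subset hsub (Set.toFinite _)
  have h3 := sum_dg (G.deleteEdges E)
  have h4 : W.ncard + ∑ x, (if x ∈ W then 0 else 1) = Fintype.card V := by
    have : W.ncard = ∑ x, (if x ∈ W then 1 else 0) := by
      rw [Set.ncard_eq_toFinset_card']; simp
    rw [this, ← Finset.sum_add_distrib, Fintype.card_eq_sum_ones]
    exact Finset.sum_congr rfl fun x _ => by split_ifs <;> rfl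
  have h5 : ∀ x, 2 * (if x ∈ W then 0 else 1) ≤ ((G.deleteEdges E).neighborSet x).ncard := by
    intro x
    split_ifs with hx
    · simp
    · have : (G.deleteEdges E).neighborSet x = G.neighborSet x := by
        ext y
        simp [hEW, hx]
      rw [this]
      exact hd x hx
  have h6 : ∑ x, 2 * (if x ∈ W then 0 else 1) = ∑ x, ((G.deleteEdges E).neighborSet x).ncard := by
    refine le_antisymm (Finset.sum_le_sum fun x _ => h5 x) ?_
    rw [h3, ← Finset.mul_sum]
    omega
  have h7 := (Finset.sum_eq_sum_iff_of_le (fun x _ => h5 x)).1 h6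
  have hclosed : ∀ a b, a ∈ W → G.Adj a b → b ∈ W := by
    intro a b ha hab
    by_contra hb
    have h8 := h7 a (Finset.mem_univ _)
    rw [if_pos ha, mul_zero, eq_comm, Set.ncard_eq_zero (Set.toFinite _)] at h8
    have : b ∈ (G.deleteEdges E).neighborSet a := by
      simp [hEW, hb, hab]
    rw [h8] at this
    exact this
  obtain ⟨w⟩ := hW.nonempty
  refine Set.eq_univ_of_forall fun x => ?_
  obtain ⟨p⟩ := hG.preconnected w.1 x
  have : ∀ a b, G.Walk a b → a ∈ W → b ∈ W := by
    intro a b p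
    induction p with
    | nil => exact id
    | cons h _ ih => exact fun ha => ih (hclosed _ _ ha h)
  exact this _ _ p w.2

lemma leaf_mem [Fintype V] {G : SimpleGraph V} {S : Set V}
    (hS : Fintype.card V ≤ steinerDist G S + 1) {H : SimpleGraph V} (hle : H ≤ G)
    (hH : H.Connected) {x : V} (hx : (H.neighborSet x).ncard = 1) : x ∈ S := by
  classical
  by_contra hxS
  have hdeg : H.degree x = 1 := by
    rw [← H.card_neighborSet_eq_degree, ← Set.toFinset_card, ← Set.ncard_eq_toFinset_card', hx]
  have h1 := hH.induce_compl_singleton_of_degree_eq_one hdeg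
  have h2 : (G.induce {x}ᶜ).Connected := h1.mono (fun a b hab => hle hab)
  have h3 := steinerDist_lt_of_induce (S := S) h2 (by
    intro y hy hyx
    rw [Set.mem_singleton_iff] at hyx
    exact hxS (hyx ▸ hy))
  have h4 := Set.ncard_add_ncard_compl ({x} : Set V)
  rw [Set.ncard_singleton, Nat.card_eq_fintype_card] at h4
  omega

lemma unicyclic_structure [Fintype V] [DecidableEq V] {G : SimpleGraph V} {S : Finset V}
    (hV : 2 ≤ Fintype.card V) (hS3 : S.card = 3)
    (hP : ∀ H ≤ G, H.Connected → ∀ x, (H.neighborSet x).ncard = 1 → x ∈ S)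
    {H : SimpleGraph V} (hle : H ≤ G) (hH : H.Connected)
    (hE : H.edgeSet.ncard = Fintype.card V) :
    ∃ u v w, H.Adj u v ∧ H.Adj v w ∧ H.Adj w u ∧
      ∀ x, (if x ∈ S then 1 else 0) + (H.neighborSet x).ncard =
        2 + if x = u ∨ x = v ∨ x = w then 1 else 0 := by
  have hna : ¬ H.IsAcyclic := by
    intro h
    have h1 := (isTree_iff_connected_and_card.1 ⟨hH, h⟩).2
    rw [Nat.card_coe_set_eq, Nat.card_eq_fintype_card] at h1
    omega
  simp only [IsAcyclic, not_forall, not_not] at hna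
  obtain ⟨a, c, hc⟩ := hna
  have hpt : ∀ x, 2 + (if x ∈ c.support.toFinset then 1 else 0) ≤
      (if x ∈ S then 1 else 0) + (H.neighborSet x).ncard := by
    intro x
    have h1 := dg_pos hH hV x
    by_cases hx : x ∈ c.support.toFinset
    · rw [if_pos hx]
      have hx' : x ∈ c.support := by simpa using hx
      have h2 := hc.ncard_neighborSet_toSubgraph_eq_two hx'
      obtain ⟨y, hy⟩ : (c.toSubgraph.neighborSet x).Nonempty := by
        apply Set.nonempty_of_ncard_ne_zero
        omega
      have hxy : H.Adj x y := c.toSubgraph.adj_sub hy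
      have hmem : s(x, y) ∈ c.edges := by
        rw [← Walk.mem_edges_toSubgraph]
        exact hy
      have hdel : (H.deleteEdges {s(x, y)}).Connected := by
        apply hH.connected_delete_edge_of_not_isBridge
        intro hb
        exact hb.notMem_edges_of_isCycle hc hmem
      have h3 := dg_del hxy x
      have h4 := dg_pos hdel hV x
      have h5 := hP _ ((deleteEdges_le _).trans hle) hdel x
      simp only [true_or, if_true] at h3
      split_ifs with hxS
      · omega
      · have : ((H.deleteEdges {s(x, y)}).neighborSet x).ncard ≠ 1 := fun h => hxS (h5 h)
        omega
    · rw [if_neg hx]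
      have h5 := hP _ hle hH x
      split_ifs with hxS
      · omega
      · have : (H.neighborSet x).ncard ≠ 1 := fun h => hxS (h5 h)
        omega
  have hsumL : ∑ x, (2 + (if x ∈ c.support.toFinset then 1 else 0)) =
      2 * Fintype.card V + c.support.toFinset.card := by
    rw [Finset.sum_add_distrib, Finset.sum_ite_mem, Finset.univ_inter]
    simp [mul_comm]
  have hsumR : ∑ x, ((if x ∈ S then 1 else 0) + (H.neighborSet x).ncard) =
      3 + 2 * Fintype.card V := by
    rw [Finset.sum_add_distrib, sum_dg, hE]
    simp [hS3]
  have hcard : c.length ≤ c.support.toFinset.card := by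
    have h1 := List.toFinset_card_of_nodup hc.support_nodup
    have h2 : c.support.tail.toFinset ⊆ c.support.toFinset := by
      intro x hx
      simp only [List.mem_toFinset] at hx ⊢
      exact List.mem_of_mem_tail hx
    have h3 := Finset.card_le_card h2
    have h4 := c.length_support
    rw [h1, List.length_tail] at h3
    omega
  have h3 := hc.three_le_length
  have hsum := Finset.sum_le_sum (fun x (_ : x ∈ Finset.univ) => hpt x)
  have heq := (Finset.sum_eq_sum_iff_of_le (fun x (_ : x ∈ Finset.univ) => hpt x)).1 (by omega)
  have hlen : c.length = 3 := by omega
  match c, hlen, heq with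
  | .cons (v := v) h1 (.cons (v := w) h2 (.cons h3 .nil)), _, heq =>
    refine ⟨a, v, w, h1, h2, h3, fun x => ?_⟩
    rw [← heq x (Finset.mem_univ _)]
    congr 1
    simp
    grind

/-- With a further edge `p q`, both ends must be adjacent to the apex opposite to `u v`. -/
lemma extra_edge_adj [Fintype V] [DecidableEq V] {G : SimpleGraph V} {S : Finset V}
    (hV : 2 ≤ Fintype.card V) (hS3 : S.card = 3)
    (hP : ∀ H ≤ G, H.Connected → ∀ x, (H.neighborSet x).ncard = 1 → x ∈ S)
    {H : SimpleGraph V} (hle : H ≤ G) (hH : H.Connected)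
    (hE : H.edgeSet.ncard = Fintype.card V) {u v w : V}
    (huv : H.Adj u v) (hvw : H.Adj v w) (hwu : H.Adj w u)
    (hd : ∀ x, (if x ∈ S then 1 else 0) + (H.neighborSet x).ncard =
        2 + if x = u ∨ x = v ∨ x = w then 1 else 0)
    {p q : V} (hpq : G.Adj p q) (hn : ¬ H.Adj p q) : p ≠ w ∧ H.Adj p w := by
  set T := H.deleteEdges {s(u, v)} with hT
  have hTH : T ≤ H := deleteEdges_le _
  have hTc : T.Connected := by
    refine connected_of_adj_reachable (fun a b hab => ?_) hH
    have h1 : T.Adj u w := by simp [hT, hwu.symm, hvw.ne', hwu.ne]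
    have h2 : T.Adj w v := by simp [hT, hvw.symm, hwu.ne, hvw.ne']
    have h3 := h1.reachable.trans h2.reachable
    by_cases h : s(a, b) = s(u, v)
    · rcases Sym2.eq_iff.1 h with ⟨rfl, rfl⟩ | ⟨rfl, rfl⟩
      · exact h3
      · exact h3.symm
    · exact Adj.reachable (by simpa [hT, hab] using h)
  have hnT : ¬ T.Adj p q := fun h => hn (hTH h)
  have hle' : T ⊔ edge p q ≤ G := by
    refine sup_le (hTH.trans hle) ?_
    intro a b hab
    rw [edge_adj] at hab
    rcases hab.1 with ⟨rfl, rfl⟩ | ⟨rfl, rfl⟩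
    · exact hpq
    · exact hpq.symm
  have hE' : (T ⊔ edge p q).edgeSet.ncard = Fintype.card V := by
    rw [edges_add hpq.ne hnT, ← edges_del huv, hE]
  obtain ⟨u', v', w', h1, h2, h3, h4⟩ :=
    unicyclic_structure hV hS3 hP hle' (hTc.mono le_sup_left) hE'
  have key : ∀ x, (if x = u' ∨ x = v' ∨ x = w' then 1 else 0) =
      (if x = w then 1 else 0) + if x = p ∨ x = q then 1 else 0 := by
    intro x
    have a1 := h4 x
    have a2 := hd x
    rw [dg_add hpq.ne hnT] at a1
    rw [dg_del huv] at a2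
    have e1 := huv.ne
    have e2 := hvw.ne
    have e3 := hwu.ne
    rw [← hT] at a2
    grind
  have kp := key p
  have kw := key w
  have hpw : p ≠ w := by
    rintro rfl
    simp at kp
    split_ifs at kp <;> omega
  refine ⟨hpw, ?_⟩
  have hqw : q ≠ w := by
    rintro rfl
    simp at kw
    split_ifs at kw <;> omega
  have hadj : (T ⊔ edge p q).Adj p w := by
    have b1 : p = u' ∨ p = v' ∨ p = w' := by
      by_contra h
      simp [h] at kp
    have b2 : w = u' ∨ w = v' ∨ w = w' := by
      by_contra h
      simp [h] at kw
      omega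
    rcases b1 with rfl | rfl | rfl <;> rcases b2 with rfl | rfl | rfl <;>
      first | exact absurd rfl hpw | assumption | (apply SimpleGraph.Adj.symm; assumption)
  rcases hadj with h | h
  · exact hTH h
  · rw [edge_adj] at h
    rcases h.1 with ⟨_, rfl⟩ | ⟨_, rfl⟩
    · exact absurd rfl hqw
    · exact absurd rfl hpw

lemma forward_direction [Fintype V] [DecidableEq V] {G : SimpleGraph V} {S : Finset V}
    (hV : 3 ≤ Fintype.card V) (hG : G.Connected) (hS3 : S.card = 3)
    (hS : Fintype.card V ≤ steinerDist G (S : Set V) + 1) :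
    IsSpiderTree G ∨ IsTriangleWithPaths G := by
  have hP : ∀ H ≤ G, H.Connected → ∀ x, (H.neighborSet x).ncard = 1 → x ∈ S :=
    fun H hle hH x hx => by simpa using leaf_mem hS hle hH hx
  by_cases htree : G.IsTree
  · left
    refine ⟨htree, ?_⟩
    have : {v : V | (G.neighborSet v).ncard = 1} ⊆ (S : Set V) :=
      fun x hx => by simpa using hP G le_rfl hG x hx
    have h := Set.ncard_le_ncard this (Set.toFinite _)
    rwa [Set.ncard_coe_finset, hS3] at h
  · right
    obtain ⟨T, hle, hT⟩ := hG.exists_isTree_le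
    have hTE := (isTree_iff_connected_and_card.1 hT).2
    rw [Nat.card_coe_set_eq, Nat.card_eq_fintype_card] at hTE
    have hne : ¬ G ≤ T := fun h => htree (le_antisymm hle h ▸ hT)
    obtain ⟨p, q, hpq, hn⟩ : ∃ p q, G.Adj p q ∧ ¬ T.Adj p q := by
      by_contra! h
      exact hne fun a b hab => h a b hab
    have hle' : T ⊔ edge p q ≤ G := by
      refine sup_le hle ?_
      intro a b hab
      rw [edge_adj] at hab
      rcases hab.1 with ⟨rfl, rfl⟩ | ⟨rfl, rfl⟩
      · exact hpq
      · exact hpq.symm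
    have hE := edges_add hpq.ne hn
    have hHc : (T ⊔ edge p q).Connected := hT.connected.mono le_sup_left
    rw [hTE] at hE
    generalize T ⊔ edge p q = H at hle' hE hHc
    have hV2 : 2 ≤ Fintype.card V := by omega
    obtain ⟨u, v, w, huv, hvw, hwu, hd⟩ := unicyclic_structure hV2 hS3 hP hle' hHc hE
    have hGH : G = H := by
      refine le_antisymm (fun a b hab => ?_) hle'
      by_contra hnab
      have r1 := extra_edge_adj hV2 hS3 hP hle' hHc hE huv hvw hwu hd hab hnab
      have r2 := extra_edge_adj hV2 hS3 hP hle' hHc hE hvw hwu huv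
        (fun x => by rw [hd x]; congr 1; grind) hab hnab
      have r3 := extra_edge_adj hV2 hS3 hP hle' hHc hE hwu huv hvw
        (fun x => by rw [hd x]; congr 1; grind) hab hnab
      have h1 : ({u, v, w} : Set V) ⊆ H.neighborSet a := by
        rintro x (rfl | rfl | rfl)
        · exact r2.2
        · exact r3.2
        · exact r1.2
      have h2 := Set.ncard_le_ncard h1 (Set.toFinite _)
      rw [Set.ncard_eq_three.2 ⟨u, v, w, huv.ne, hwu.ne', hvw.ne, rfl⟩] at h2
      have h3 := hd a
      rw [if_neg (show ¬ (a = u ∨ a = v ∨ a = w) by simp [r1.1, r2.1, r3.1])] at h3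
      omega
    subst hGH
    refine ⟨hG, hE, u, v, w, huv.ne, hwu.ne', hvw.ne, huv, hwu.symm, hvw, ?_, ?_, ?_, ?_⟩
    · have := hd u
      simp only [true_or, if_true] at this
      omega
    · have := hd v
      simp only [true_or, or_true, if_true] at this
      omega
    · have := hd w
      simp only [or_true, if_true] at this
      omega
    · intro x h1 h2 h3
      have := hd x
      rw [if_neg (show ¬ (x = u ∨ x = v ∨ x = w) by simp [h1, h2, h3])] at this
      omega

lemma spider_steinerDist [Fintype V] {G : SimpleGraph V} (hV : 3 ≤ Fintype.card V)
    (h : IsSpiderTree G) :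
    ∃ S : Finset V, S.card = 3 ∧ Fintype.card V ≤ steinerDist G (S : Set V) + 1 := by
  classical
  obtain ⟨hT, hL⟩ := h
  rw [Set.ncard_eq_toFinset_card'] at hL
  obtain ⟨S, hLS, hS⟩ := Finset.exists_superset_card_eq hL hV
  refine ⟨S, hS, le_steinerDist hT.connected fun W hSW hW => ?_⟩
  have hTE := (isTree_iff_connected_and_card.1 hT).2
  rw [Nat.card_coe_set_eq, Nat.card_eq_fintype_card] at hTE
  refine tree_connected_set_univ hT.connected hTE hW fun x hx => ?_
  have h1 := dg_pos hT.connected (by omega) x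
  by_contra h2
  have h3 : (G.neighborSet x).ncard = 1 := by omega
  exact hx (hSW (hLS (Set.mem_toFinset.2 h3)))

/-- If `a b` is an edge of a triangle `a b c` of a connected unicyclic graph and it can be
deleted without harm, then a connected set containing all small-degree vertices is everything. -/
lemma triangle_delete [Fintype V] {G : SimpleGraph V} (hG : G.Connected)
    (hE : G.edgeSet.ncard = Fintype.card V) {a b c : V} (hab : G.Adj a b) (hbc : G.Adj b c)
    (hca : G.Adj c a) {W : Set V} (hW : (G.induce W).Connected)
    (hd : ∀ x, x ∉ W → 2 ≤ (G.neighborSet x).ncard)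
    (ha : a ∉ W → 3 ≤ (G.neighborSet a).ncard) (hb : b ∉ W → 3 ≤ (G.neighborSet b).ncard)
    (hc : a ∈ W → b ∈ W → c ∈ W) : W = Set.univ := by
  classical
  set T := G.deleteEdges {s(a, b)} with hT
  have h1 : T.Adj a c := by simp [hT, hca.symm, hbc.ne', hca.ne]
  have h2 : T.Adj c b := by simp [hT, hbc.symm, hca.ne, hbc.ne']
  have hTc : T.Connected := by
    refine connected_of_adj_reachable (fun x y hxy => ?_) hG
    have h3 := h1.reachable.trans h2.reachable
    by_cases h : s(x, y) = s(a, b)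
    · rcases Sym2.eq_iff.1 h with ⟨rfl, rfl⟩ | ⟨rfl, rfl⟩
      · exact h3
      · exact h3.symm
    · exact Adj.reachable (by simpa [hT, hxy] using h)
  have hWc : (T.induce W).Connected := by
    refine connected_of_adj_reachable (fun x y hxy => ?_) hW
    have hxy' : G.Adj x.1 y.1 := hxy
    by_cases h : s(x.1, y.1) = s(a, b)
    · have h3 : ∀ (ha : a ∈ W) (hb : b ∈ W), (T.induce W).Reachable ⟨a, ha⟩ ⟨b, hb⟩ := by
        intro ha hb
        have e1 : (T.induce W).Adj ⟨a, ha⟩ ⟨c, hc ha hb⟩ := h1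
        have e2 : (T.induce W).Adj ⟨c, hc ha hb⟩ ⟨b, hb⟩ := h2
        exact e1.reachable.trans e2.reachable
      obtain ⟨x, hx⟩ := x
      obtain ⟨y, hy⟩ := y
      rcases Sym2.eq_iff.1 h with ⟨h4, h5⟩ | ⟨h4, h5⟩
      · dsimp only at h4 h5
        subst h4 h5
        exact h3 hx hy
      · dsimp only at h4 h5
        subst h4 h5
        exact (h3 hy hx).symm
    · have e : (T.induce W).Adj x y := by
        change T.Adj x.1 y.1
        simpa [hT, hxy'] using h
      exact e.reachable
  have hTE := edges_del hab
  refine tree_connected_set_univ hTc (by rw [← hE, hTE]) hWc fun x hx => ?_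
  have e := dg_del hab x
  have e2 := hd x hx
  rw [← hT] at e
  by_cases hxa : x = a
  · subst hxa
    have := ha hx
    simp only [true_or, if_true] at e
    omega
  · by_cases hxb : x = b
    · subst hxb
      have := hb hx
      simp only [or_true, if_true] at e
      omega
    · simp only [hxa, hxb, or_self, if_false] at e
      omega

lemma triangle_steinerDist [Fintype V] {G : SimpleGraph V} (hV : 3 ≤ Fintype.card V)
    (h : IsTriangleWithPaths G) :
    ∃ S : Finset V, S.card = 3 ∧ Fintype.card V ≤ steinerDist G (S : Set V) + 1 := by
  classical
  obtain ⟨hG, hE, u, v, w, huv, huw, hvw, auv, auw, avw, du, dv, dw, dx⟩ := h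
  let U : Finset V := {u, v, w}
  let L : Finset V := Finset.univ.filter fun x =>
    (G.neighborSet x).ncard ≤ 1 ∨ (x ∈ U ∧ (G.neighborSet x).ncard ≤ 2)
  have hU : U.card = 3 := Finset.card_eq_three.2 ⟨u, v, w, huv, huw, hvw, rfl⟩
  have hpt : ∀ x, (if x ∈ L then 1 else 0) + (G.neighborSet x).ncard ≤
      2 + (if x ∈ U then 1 else 0) := by
    intro x
    have hx : x ∈ L ↔ ((G.neighborSet x).ncard ≤ 1 ∨ (x ∈ U ∧ (G.neighborSet x).ncard ≤ 2)) := by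
      simp [L]
    have hxU : x ∈ U ↔ x = u ∨ x = v ∨ x = w := by simp [U]
    by_cases hU : x ∈ U
    · have hd3 : (G.neighborSet x).ncard ≤ 3 := by
        rcases hxU.1 hU with rfl | rfl | rfl <;> assumption
      rw [if_pos hU]
      split_ifs with hL
      · rcases hx.1 hL with h | h <;> omega
      · omega
    · have hd2 : (G.neighborSet x).ncard ≤ 2 := by
        rw [hxU] at hU
        push Not at hU
        exact dx x hU.1 hU.2.1 hU.2.2
      rw [if_neg hU]
      split_ifs with hL
      · rcases hx.1 hL with h | h
        · omega
        · exact absurd h.1 hU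
      · omega
  have hsum := Finset.sum_le_sum (fun x (_ : x ∈ Finset.univ) => hpt x)
  rw [Finset.sum_add_distrib, Finset.sum_add_distrib, sum_dg, hE, Finset.sum_ite_mem,
    Finset.sum_ite_mem, Finset.univ_inter, Finset.univ_inter] at hsum
  simp only [Finset.sum_const, Finset.card_univ, smul_eq_mul, mul_one, hU] at hsum
  obtain ⟨S, hLS, hS⟩ := Finset.exists_superset_card_eq (s := L) (n := 3) (by omega) hV
  refine ⟨S, hS, le_steinerDist hG fun W hSW hW => ?_⟩
  have hd : ∀ x, x ∉ W → 2 ≤ (G.neighborSet x).ncard := by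
    intro x hx
    by_contra h
    exact hx (hSW (hLS (Finset.mem_filter.2 ⟨Finset.mem_univ _, Or.inl (by omega)⟩)))
  have hd3 : ∀ x ∈ U, x ∉ W → 3 ≤ (G.neighborSet x).ncard := by
    intro x hxU hx
    by_contra h
    exact hx (hSW (hLS (Finset.mem_filter.2 ⟨Finset.mem_univ _, Or.inr ⟨hxU, by omega⟩⟩)))
  have hu := hd3 u (by simp [U])
  have hv := hd3 v (by simp [U])
  have hw := hd3 w (by simp [U])
  by_cases hwW : u ∈ W → v ∈ W → w ∈ W
  · exact triangle_delete hG hE auv avw auw.symm hW hd hu hv hwW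
  · push Not at hwW
    exact triangle_delete hG hE auw avw.symm auv.symm hW hd hu hw (fun _ h => absurd h hwW.2.2)

end SteinerHelpers

/-- For a connected graph `G` of order `n ≥ 3`, `sdiam_3(G) = n - 1` iff `G` is a tree
`T_{a,b,c}` or a unicyclic graph `△_{p,q,r}`. -/
theorem steinerDiam_three_eq_top_iff {V : Type*} [Fintype V] [DecidableEq V]
    (G : SimpleGraph V) (n : ℕ) (hn : Fintype.card V = n) (hn3 : 3 ≤ n)
    (hG : G.Connected) :
    steinerDiam G 3 = n - 1 ↔ IsSpiderTree G ∨ IsTriangleWithPaths G := by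
  subst hn
  have hle : ∀ S : Finset V, steinerDist G (S : Set V) + 1 ≤ Fintype.card V :=
    fun S => steinerDist_lt_card hG _
  constructor
  · intro h
    have hne : (Finset.univ.powersetCard 3 : Finset (Finset V)).Nonempty :=
      Finset.powersetCard_nonempty.2 (by simpa using hn3)
    obtain ⟨S, hS, hSeq⟩ := Finset.exists_mem_eq_sup _ hne
      (fun S : Finset V => steinerDist G (S : Set V))
    refine forward_direction hn3 hG (Finset.mem_powersetCard.1 hS).2 ?_
    have : steinerDiam G 3 = steinerDist G (S : Set V) := hSeq
    omega
  · intro h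
    obtain ⟨S, hS, hd⟩ : ∃ S : Finset V, S.card = 3 ∧
        Fintype.card V ≤ steinerDist G (S : Set V) + 1 := by
      rcases h with h | h
      · exact spider_steinerDist hn3 h
      · exact triangle_steinerDist hn3 h
    have h1 : steinerDist G (S : Set V) ≤ steinerDiam G 3 :=
      Finset.le_sup (f := fun S : Finset V => steinerDist G (S : Set V))
        (Finset.mem_powersetCard.2 ⟨Finset.subset_univ _, hS⟩)
    have h2 : steinerDiam G 3 ≤ Fintype.card V - 1 := by
      refine Finset.sup_le fun S' _ => ?_
      have := hle S'
      omega
    omega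
end

section
/- Let n and k be integers with 3 ≤ k ≤ n, and let G be a simple graph of order n such that both G and its complement Ḡ are connected. Then sdiam_k(G) + sdiam_k(Ḡ) ≤ max{n + k − 1, 4k − 2}. Moreover, sdiam_k(G) + sdiam_k(Ḡ) ≥ 2k − 2, and if in addition n ≥ 2k − 2 then sdiam_k(G) + sdiam_k(Ḡ) ≥ 2k − 1. -/
open SimpleGraph

section helpers

variable {V : Type*} [Fintype V] [DecidableEq V]

/-- A connected induced subgraph on `W ⊇ S` bounds the Steiner distance. -/
lemma steinerDist_le_of_induce {G : SimpleGraph V} {S : Set V} {W : Finset V}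
    (hS : S ⊆ (W : Set V)) (hW : (G.induce (W : Set V)).Connected) :
    steinerDist G S ≤ W.card - 1 := by
  classical
  obtain ⟨T, hT, hTree⟩ := hW.exists_isTree_le
  let f : T →g G := ⟨fun x => x.1, fun {a b} h => by simpa using hT h⟩
  have hcard := hTree.card_edgeFinset
  have hc : (Subgraph.map f (⊤ : T.Subgraph)).edgeSet.ncard ≤ W.card - 1 := by
    rw [Subgraph.edgeSet_map, Subgraph.edgeSet_top]
    refine (Set.ncard_image_le (Set.toFinite _)).trans ?_
    rw [← coe_edgeFinset, Set.ncard_coe_finset]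
    have : Fintype.card (W : Set V) = W.card := by simp
    omega
  refine le_trans (Nat.sInf_le ⟨Subgraph.map f (⊤ : T.Subgraph), ?_, ?_, rfl⟩) hc
  · rw [Subgraph.connected_iff']
    refine hTree.connected.map (H := (Subgraph.map f (⊤ : T.Subgraph)).coe)
      ⟨fun x => ⟨f x, ⟨x, by simp, rfl⟩⟩, fun {a b} h => ?_⟩ ?_
    · exact ⟨a, b, h, rfl, rfl⟩
    · rintro ⟨_, x, -, rfl⟩
      exact ⟨x, rfl⟩
  · intro x hx
    exact ⟨⟨x, hS hx⟩, by simp, rfl⟩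

lemma steinerDist_attained {G : SimpleGraph V} (hG : G.Connected) (S : Set V) :
    ∃ H : G.Subgraph, H.Connected ∧ S ⊆ H.verts ∧ H.edgeSet.ncard = steinerDist G S := by
  have : {m | ∃ H : G.Subgraph, H.Connected ∧ S ⊆ H.verts ∧ H.edgeSet.ncard = m}.Nonempty := by
    refine ⟨_, ⊤, ?_, by simp, rfl⟩
    rw [Subgraph.connected_iff']
    exact (Subgraph.topIso.connected_iff).2 hG
  exact Nat.sInf_mem this

lemma subgraph_verts_le {G : SimpleGraph V} {H : G.Subgraph} (h : H.Connected) :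
    H.verts.ncard ≤ H.edgeSet.ncard + 1 := by
  have h1 := h.coe.card_vert_le_card_edgeSet_add_one
  rw [Nat.card_coe_set_eq] at h1
  refine h1.trans ?_
  rw [← Subgraph.image_coe_edgeSet_coe,
    Set.ncard_image_of_injective _ (Sym2.map.injective Subtype.val_injective),
    Nat.card_coe_set_eq]

lemma card_le_steinerDist {G : SimpleGraph V} (hG : G.Connected) (S : Finset V) :
    S.card ≤ steinerDist G (S : Set V) + 1 := by
  obtain ⟨H, hH, hS, he⟩ := steinerDist_attained hG (S : Set V)
  have h1 := subgraph_verts_le hH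
  have h2 := Set.ncard_le_ncard hS (Set.toFinite _)
  rw [Set.ncard_coe_finset] at h2
  omega

/-- If `v` has no neighbour in `S`, the Steiner distance is at least `|S|`. -/
lemma card_le_steinerDist_of_isolated {G : SimpleGraph V} (hG : G.Connected) (S : Finset V)
    (hS2 : 2 ≤ S.card) {v : V} (hv : v ∈ S) (hiso : ∀ w ∈ S, ¬ G.Adj v w) :
    S.card ≤ steinerDist G (S : Set V) := by
  obtain ⟨H, hH, hS, he⟩ := steinerDist_attained hG (S : Set V)
  have h1 := subgraph_verts_le hH
  by_contra hlt
  have heq : (S : Set V) = H.verts := by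
    apply Set.eq_of_subset_of_ncard_le hS _ (Set.toFinite _)
    rw [Set.ncard_coe_finset]
    omega
  have hnt : H.verts.Nontrivial := by
    rw [← heq]
    exact Finset.one_lt_card_iff_nontrivial.1 hS2
  have := hnt.coe_sort
  obtain ⟨u, hu⟩ := hH.preconnected.exists_adj_of_nontrivial ⟨v, hS hv⟩
  refine hiso u ?_ hu.adj_sub
  have : u ∈ H.verts := H.edge_vert hu.symm
  rw [← heq] at this
  exact this

lemma steinerDist_le_diam (G : SimpleGraph V) {k : ℕ} {S : Finset V} (hS : S.card = k) :
    steinerDist G (S : Set V) ≤ steinerDiam G k :=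
  Finset.le_sup (f := fun S : Finset V => steinerDist G (S : Set V))
    (by simp [Finset.mem_powersetCard, hS])

lemma induce_connected_of_compl {G : SimpleGraph V} {W : Set V} (hW : W.Nonempty)
    (h : ¬ (Gᶜ.induce W).Connected) : (G.induce W).Connected := by
  have := hW.to_subtype
  rcases (G.induce W).connected_or_connected_compl with h1 | h1
  · exact h1
  · refine absurd ?_ h
    convert h1 using 1
    ext a b
    simp [Subtype.ext_iff]

/-- If the complement has a `k`-set of Steiner distance more than `k`, then `G` has Steiner
`k`-diameter at most `2k-1`. -/
lemma steinerDiam_le_of_compl {G : SimpleGraph V} {k : ℕ} (hk : 3 ≤ k)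
    (h : k < steinerDiam Gᶜ k) : steinerDiam G k ≤ 2 * k - 1 := by
  obtain ⟨S, hS, hd⟩ := Finset.lt_sup_iff.1 h
  rw [Finset.mem_powersetCard] at hS
  have hins : ∀ v, (G.induce ((insert v S : Finset V) : Set V)).Connected := by
    intro v
    apply induce_connected_of_compl ⟨v, by simp⟩
    intro hc
    have h1 := steinerDist_le_of_induce (S := (S : Set V)) (by simp) hc
    have h2 := Finset.card_insert_le v S
    omega
  obtain ⟨s, hs⟩ : S.Nonempty := Finset.card_pos.1 (by omega)
  refine Finset.sup_le fun T hT => ?_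
  rw [Finset.mem_powersetCard] at hT
  have hcon : (G.induce ((T ∪ S : Finset V) : Set V)).Connected := by
    rw [connected_iff_exists_forall_reachable]
    refine ⟨⟨s, by simp [hs]⟩, ?_⟩
    rintro ⟨v, hv⟩
    have hsub : ((insert v S : Finset V) : Set V) ⊆ ((T ∪ S : Finset V) : Set V) := by
      intro x hx
      simp only [Finset.coe_insert, Set.mem_insert_iff] at hx
      rcases hx with rfl | hx
      · exact hv
      · simp only [Finset.coe_union]
        exact Or.inr hx
    exact ((hins v).preconnected ⟨s, by simp [hs]⟩ ⟨v, by simp⟩).map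
      (induceHomOfLE G hsub).toHom
  have h1 := steinerDist_le_of_induce (S := (T : Set V)) (by simp) hcon
  have h2 := Finset.card_union_le T S
  show steinerDist G (T : Set V) ≤ _
  omega

lemma steinerDiam_le_card {G : SimpleGraph V} (hG : G.Connected) (k : ℕ) :
    steinerDiam G k ≤ Fintype.card V - 1 := by
  refine Finset.sup_le fun T _ => ?_
  refine steinerDist_le_of_induce (W := Finset.univ) (by simp) ?_
  rw [Finset.coe_univ]
  exact (induceUnivIso G).connected_iff.2 hG

lemma le_steinerDiam_of_nonadj {G : SimpleGraph V} (hG : G.Connected) {k : ℕ} (hk : 3 ≤ k)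
    (v : V) (A : Finset V) (hA : k - 1 ≤ A.card) (hv : v ∉ A) (hadj : ∀ w ∈ A, ¬ G.Adj v w) :
    k ≤ steinerDiam G k := by
  obtain ⟨B, hB, hBc⟩ := Finset.exists_subset_card_eq hA
  have hc : (insert v B).card = k := by
    rw [Finset.card_insert_of_notMem (fun h => hv (hB h))]
    omega
  have h1 := card_le_steinerDist_of_isolated hG (insert v B) (by omega) (v := v) (by simp) (by
    intro w hw
    rcases Finset.mem_insert.1 hw with rfl | hw
    · exact G.loopless.irrefl _
    · exact hadj w (hB hw))
  have h2 := steinerDist_le_diam G hc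
  omega

end helpers

/-- Nordhaus–Gaddum bounds for the sum `sdiam_k(G) + sdiam_k(Ḡ)` where `3 ≤ k ≤ n` and
both `G` and its complement are connected. -/
theorem steinerDiam_add_compl_bounds {V : Type*} [Fintype V] [DecidableEq V]
    (G : SimpleGraph V) (n k : ℕ) (hn : Fintype.card V = n)
    (hk : 3 ≤ k) (hkn : k ≤ n) (hG : G.Connected) (hGc : Gᶜ.Connected) :
    steinerDiam G k + steinerDiam Gᶜ k ≤ max (n + k - 1) (4 * k - 2) ∧
    2 * k - 2 ≤ steinerDiam G k + steinerDiam Gᶜ k ∧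
    (2 * k - 2 ≤ n → 2 * k - 1 ≤ steinerDiam G k + steinerDiam Gᶜ k) := by
  classical
  have lowG : ∀ G' : SimpleGraph V, G'.Connected → k - 1 ≤ steinerDiam G' k := by
    intro G' hG'
    obtain ⟨S, -, hS⟩ := Finset.exists_subset_card_eq
      (show k ≤ (Finset.univ : Finset V).card by rw [Finset.card_univ]; omega)
    have h1 := card_le_steinerDist hG' S
    have h2 := steinerDist_le_diam G' hS
    omega
  have l1 := lowG G hG
  have l2 := lowG Gᶜ hGc
  have u1 := steinerDiam_le_card hG k
  have u2 := steinerDiam_le_card hGc k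
  refine ⟨?_, by omega, fun hn2 => ?_⟩
  · rw [le_max_iff]
    by_cases c1 : k < steinerDiam Gᶜ k
    · have := steinerDiam_le_of_compl hk c1
      by_cases c2 : k < steinerDiam G k
      · have h2 := steinerDiam_le_of_compl (G := Gᶜ) hk (by rwa [compl_compl])
        omega
      · omega
    · omega
  · obtain ⟨v⟩ := hG.nonempty
    have hsum := Finset.card_filter_add_card_filter_not
      (s := (Finset.univ : Finset V).erase v) (fun w => G.Adj v w)
    rw [Finset.card_erase_of_mem (Finset.mem_univ v), Finset.card_univ] at hsum
    by_cases c : k - 1 ≤ (((Finset.univ : Finset V).erase v).filter (fun w => G.Adj v w)).card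
    · have := le_steinerDiam_of_nonadj hGc hk v _ c (by simp) (by
        intro w hw
        simp at hw
        simp [hw])
      omega
    · have := le_steinerDiam_of_nonadj hG hk v
        (((Finset.univ : Finset V).erase v).filter (fun w => ¬ G.Adj v w))
        (by omega) (by simp) (by
        intro w hw
        simp at hw
        exact hw.2)
      omega
end

section
/- Let G be a simple graph of order n ≥ 5 such that both G and its complement Ḡ are connected. Then 2n − 4 ≤ sdiam_{n−1}(G) + sdiam_{n−1}(Ḡ) ≤ 2n − 2 and (n − 2)² ≤ sdiam_{n−1}(G) · sdiam_{n−1}(Ḡ) ≤ (n − 1)². -/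
open SimpleGraph

theorem steinerDist_le {V : Type*} [Fintype V] (G : SimpleGraph V) (hG : G.Connected)
    (S : Set V) : steinerDist G S ≤ Fintype.card V - 1 := by
  classical
  obtain ⟨T, hT, ht⟩ := hG.exists_isTree_le
  refine Nat.sInf_le ⟨toSubgraph T hT, ht.connected.toSubgraph hT, by simp, ?_⟩
  have h1 : (toSubgraph T hT).edgeSet = T.edgeSet := by
    ext e
    induction e with
    | h a b => rfl
  have h2 := ht.card_edgeFinset
  rw [h1, ← coe_edgeFinset, Set.ncard_coe_finset]
  omega

theorem le_steinerDist_s10 {V : Type*} [Fintype V] (G : SimpleGraph V) (hG : G.Connected)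
    (S : Finset V) : S.card - 1 ≤ steinerDist G (S : Set V) := by
  classical
  have hne : {m | ∃ H : G.Subgraph, H.Connected ∧ (S : Set V) ⊆ H.verts ∧
      H.edgeSet.ncard = m}.Nonempty :=
    ⟨_, toSubgraph G le_rfl, hG.toSubgraph le_rfl, by simp, rfl⟩
  obtain ⟨H, hc, hS, hm⟩ := Nat.sInf_mem hne
  unfold steinerDist
  rw [← hm, ← H.image_coe_edgeSet_coe,
    Set.ncard_image_of_injective _ (Sym2.map.injective Subtype.val_injective)]
  have h1 := hc.coe.card_vert_le_card_edgeSet_add_one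
  have h2 := Set.ncard_le_ncard hS (Set.toFinite _)
  rw [Set.ncard_coe_finset] at h2
  rw [Nat.card_coe_set_eq, Nat.card_coe_set_eq] at h1
  omega

theorem steinerDiam_pred_bounds {V : Type*} [Fintype V] [DecidableEq V]
    (G : SimpleGraph V) (hG : G.Connected) :
    Fintype.card V - 2 ≤ steinerDiam G (Fintype.card V - 1) ∧
      steinerDiam G (Fintype.card V - 1) ≤ Fintype.card V - 1 := by
  constructor
  · obtain ⟨S, hS⟩ := Finset.powersetCard_nonempty.2
      (show Fintype.card V - 1 ≤ (Finset.univ : Finset V).card by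
        rw [Finset.card_univ]; omega)
    have h1 := le_steinerDist_s10 G hG S
    have h2 : steinerDist G (S : Set V) ≤ steinerDiam G (Fintype.card V - 1) :=
      Finset.le_sup (f := fun S : Finset V => steinerDist G (S : Set V)) hS
    have h3 := (Finset.mem_powersetCard.1 hS).2
    omega
  · exact Finset.sup_le fun S _ => steinerDist_le G hG _

/-- For a graph `G` of order `n ≥ 5` with `G` and `Ḡ` connected,
`2n - 4 ≤ sdiam_{n-1}(G) + sdiam_{n-1}(Ḡ) ≤ 2n - 2` and
`(n-2)² ≤ sdiam_{n-1}(G) · sdiam_{n-1}(Ḡ) ≤ (n-1)²`. -/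
theorem steinerDiam_pred_nordhaus_gaddum {V : Type*} [Fintype V] [DecidableEq V]
    (G : SimpleGraph V) (n : ℕ) (hn : Fintype.card V = n) (hn5 : 5 ≤ n)
    (hG : G.Connected) (hGc : Gᶜ.Connected) :
    (2 * n - 4 ≤ steinerDiam G (n - 1) + steinerDiam Gᶜ (n - 1) ∧
      steinerDiam G (n - 1) + steinerDiam Gᶜ (n - 1) ≤ 2 * n - 2) ∧
    ((n - 2) ^ 2 ≤ steinerDiam G (n - 1) * steinerDiam Gᶜ (n - 1) ∧
      steinerDiam G (n - 1) * steinerDiam Gᶜ (n - 1) ≤ (n - 1) ^ 2) := by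
  subst hn
  obtain ⟨a1, a2⟩ := steinerDiam_pred_bounds G hG
  obtain ⟨b1, b2⟩ := steinerDiam_pred_bounds Gᶜ hGc
  refine ⟨⟨by omega, by omega⟩, ?_, ?_⟩
  · rw [sq]; exact Nat.mul_le_mul a1 b1
  · rw [sq]; exact Nat.mul_le_mul a2 b2
end

section
/- Let G be a simple graph of order n ≥ 10 such that both G and its complement Ḡ are connected. Then 6 ≤ sdiam_3(G) + sdiam_3(Ḡ) ≤ n + 2 and 9 ≤ sdiam_3(G) · sdiam_3(Ḡ) ≤ 3(n − 1). -/
open SimpleGraph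

/-- There is a connected subgraph containing `S` with at most `m` edges. -/
def SteinerLe {V : Type*} (G : SimpleGraph V) (m : ℕ) (S : Set V) : Prop :=
  ∃ H : G.Subgraph, H.Connected ∧ S ⊆ H.verts ∧ H.edgeSet.ncard ≤ m

theorem SteinerLe.dist_le {V : Type*} {G : SimpleGraph V} {m : ℕ} {S : Set V}
    (h : SteinerLe G m S) : steinerDist G S ≤ m := by
  obtain ⟨H, h1, h2, h3⟩ := h
  have h4 : steinerDist G S ≤ H.edgeSet.ncard := Nat.sInf_le ⟨H, h1, h2, rfl⟩
  exact h4.trans h3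

theorem SteinerLe.mono {V : Type*} {G : SimpleGraph V} {m k : ℕ} {S T : Set V}
    (h : SteinerLe G m S) (hTS : T ⊆ S) (hk : m ≤ k) : SteinerLe G k T := by
  obtain ⟨H, h1, h2, h3⟩ := h
  exact ⟨H, h1, hTS.trans h2, h3.trans hk⟩

theorem SteinerLe.single {V : Type*} (G : SimpleGraph V) (v : V) : SteinerLe G 0 {v} :=
  ⟨G.singletonSubgraph v, Subgraph.singletonSubgraph_connected, by simp, by simp⟩

theorem SteinerLe.ext {V : Type*} {G : SimpleGraph V} {m : ℕ} {S : Set V}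
    (h : SteinerLe G m S) (v w : V) (hv : v ∈ S) (hvw : G.Adj v w) :
    SteinerLe G (m + 1) (insert w S) := by
  obtain ⟨H, h1, h2, h3⟩ := h
  refine ⟨H ⊔ G.subgraphOfAdj hvw, ?_, ?_, ?_⟩
  · exact Subgraph.connected_sup h1.preconnected (Subgraph.subgraphOfAdj_connected hvw).preconnected ⟨v, h2 hv, by simp⟩
  · intro x hx
    rcases hx with rfl | hx
    · simp
    · exact Or.inl (h2 hx)
  · rw [Subgraph.edgeSet_sup, edgeSet_subgraphOfAdj]
    refine (Set.ncard_union_le _ _).trans ?_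
    simpa using h3

theorem SteinerLe.ext' {V : Type*} {G : SimpleGraph V} {m : ℕ} {S : Set V}
    (h : SteinerLe G m S) (w : V) (hv : w ∈ S ∨ ∃ v ∈ S, G.Adj v w) :
    SteinerLe G (m + 1) (insert w S) := by
  rcases hv with hv | ⟨v, hv, hvw⟩
  · exact h.mono (Set.insert_subset hv subset_rfl) (by omega)
  · exact h.ext v w hv hvw

theorem steinerLe_univ {V : Type*} [Fintype V] (G : SimpleGraph V) (hG : G.Connected) :
    SteinerLe G (Fintype.card V - 1) Set.univ := by
  classical
  obtain ⟨T, hT, hT'⟩ := hG.exists_isTree_le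
  refine ⟨toSubgraph T hT, hT'.1.toSubgraph hT, by simp [toSubgraph], ?_⟩
  have h := hT'.card_edgeFinset
  have h2 : (toSubgraph T hT).edgeSet = T.edgeSet := by
    ext e
    induction e using Sym2.ind
    simp [toSubgraph]
  rw [h2, ← coe_edgeFinset, Set.ncard_coe_finset]
  omega

theorem dominating {V : Type*} {G : SimpleGraph V} {A : Set V} (hA : SteinerLe G 2 A)
    (hd : ∀ w, w ∈ A ∨ ∃ v ∈ A, G.Adj v w) (p q r : V) : SteinerLe G 5 {p, q, r} := by
  have aux : ∀ {B : Set V}, A ⊆ B → ∀ w, w ∈ B ∨ ∃ v ∈ B, G.Adj v w := by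
    intro B hB w
    rcases hd w with h | ⟨v, hv, h⟩
    · exact Or.inl (hB h)
    · exact Or.inr ⟨v, hB hv, h⟩
  have h1 := hA.ext' p (hd p)
  have h2 := h1.ext' q (aux (by grind) q)
  have h3 := h2.ext' r (aux (by grind) r)
  exact h3.mono (by grind) (by omega)

theorem steiner_path {V : Type*} {G : SimpleGraph V} {x y z : V} (h1 : G.Adj x y)
    (h2 : G.Adj x z) : SteinerLe G 2 {x, y, z} :=
  (((SteinerLe.single G x).ext x y (by simp) h1).ext x z (by simp) h2).mono
    (by grind) (by omega)

/-- A triple at Steiner distance at least four yields a dominating path in the complement. -/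
theorem compl_dominating {V : Type*} {G : SimpleGraph V} {x y z : V}
    (hxy : x ≠ y) (hxz : x ≠ z) (hyz : y ≠ z) (h : ¬ SteinerLe G 3 {x, y, z}) (p q r : V) :
    SteinerLe Gᶜ 5 {p, q, r} := by
  have key : ∀ a b c, ({a, b, c} : Set V) = {x, y, z} → a ≠ b → a ≠ c → b ≠ c →
      ¬ G.Adj a b → ¬ G.Adj a c → SteinerLe Gᶜ 5 {p, q, r} := by
    intro a b c hs hab hac hbc h1 h2
    refine dominating (A := {a, b, c}) (steiner_path (by simp [*]) (by simp [*])) ?_ p q r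
    intro w
    by_contra hw
    push Not at hw
    obtain ⟨hw1, hw2⟩ := hw
    have ha := hw2 a (by simp)
    have hb := hw2 b (by simp)
    have hc := hw2 c (by simp)
    simp only [Set.mem_insert_iff, Set.mem_singleton_iff, not_or] at hw1
    rw [compl_adj] at ha hb hc
    have ha' : G.Adj w a := by by_contra hh; exact ha ⟨by grind, fun h => hh h.symm⟩
    have hb' : G.Adj w b := by by_contra hh; exact hb ⟨by grind, fun h => hh h.symm⟩
    have hc' : G.Adj w c := by by_contra hh; exact hc ⟨by grind, fun h => hh h.symm⟩
    refine h ?_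
    rw [← hs]
    exact ((steiner_path ha' hb').ext w c (by simp) hc').mono (by grind) (by omega)
  have two : ∀ a b c, ({a, b, c} : Set V) = {x, y, z} → G.Adj a b → G.Adj a c → False := by
    intro a b c hs h1 h2
    exact h (hs ▸ (steiner_path h1 h2).mono subset_rfl (by omega))
  have t1 := two x y z rfl
  have t2 := two y x z (by grind)
  have t3 := two z x y (by grind)
  by_cases a1 : G.Adj x y
  · exact key z x y (by grind) hxz.symm hyz.symm hxy (fun h => t1 a1 h.symm)
      (fun h => t2 a1.symm h.symm)
  · by_cases a2 : G.Adj x z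
    · exact key y x z (by grind) hxy.symm hyz hxz (fun h => a1 h.symm)
        (fun h => t3 a2.symm h.symm)
    · exact key x y z rfl hxy hxz hyz a1 a2

theorem diam_le {V : Type*} [Fintype V] [DecidableEq V] {G : SimpleGraph V} {m : ℕ}
    (h : ∀ x y z, x ≠ y → x ≠ z → y ≠ z → SteinerLe G m {x, y, z}) :
    steinerDiam G 3 ≤ m := by
  refine Finset.sup_le fun S hS => ?_
  rw [Finset.mem_powersetCard] at hS
  obtain ⟨x, y, z, h1, h2, h3, rfl⟩ := Finset.card_eq_three.1 hS.2
  simpa using (h x y z h1 h2 h3).dist_le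

theorem diam_dichotomy {V : Type*} [Fintype V] [DecidableEq V] (G : SimpleGraph V) :
    steinerDiam G 3 ≤ 3 ∨ steinerDiam Gᶜ 3 ≤ 5 := by
  by_cases h : ∀ x y z, x ≠ y → x ≠ z → y ≠ z → SteinerLe G 3 {x, y, z}
  · exact Or.inl (diam_le h)
  · push Not at h
    obtain ⟨x, y, z, h1, h2, h3, h4⟩ := h
    exact Or.inr (diam_le fun p q r _ _ _ => compl_dominating h1 h2 h3 h4 p q r)

theorem diam_le_card {V : Type*} [Fintype V] [DecidableEq V] {G : SimpleGraph V}
    (hG : G.Connected) : steinerDiam G 3 ≤ Fintype.card V - 1 :=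
  diam_le fun _ _ _ _ _ _ => (steinerLe_univ G hG).mono (Set.subset_univ _) le_rfl

theorem exists_path {V : Type*} [Fintype V] [DecidableEq V] {G : SimpleGraph V}
    (hG : G.Connected) (hc : 10 ≤ Fintype.card V) :
    ∃ x y z, y ≠ z ∧ G.Adj x y ∧ G.Adj x z := by
  have : Nontrivial V := Fintype.one_lt_card_iff_nontrivial.1 (by omega)
  obtain ⟨a⟩ := hG.nonempty
  obtain ⟨b, hab⟩ := hG.preconnected.exists_adj_of_nontrivial a
  have : ∃ c, c ∉ ({a, b} : Finset V) := by
    by_contra hh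
    push Not at hh
    have h1 : Fintype.card V ≤ ({a, b} : Finset V).card :=
      Finset.card_le_card (fun x _ => hh x)
    have := Finset.card_le_two (a := a) (b := b)
    omega
  obtain ⟨c, hc⟩ := this
  obtain ⟨w⟩ := hG.preconnected a c
  obtain ⟨d, _, h1, h2⟩ := w.exists_boundary_dart (({a, b} : Finset V) : Set V) (by simp)
    (by simpa using hc)
  have hd := d.adj
  simp only [Finset.coe_insert, Finset.coe_singleton, Set.mem_insert_iff,
    Set.mem_singleton_iff, not_or] at h1 h2
  rcases h1 with h1 | h1
  · rw [h1] at hd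
    exact ⟨a, b, d.snd, fun h => h2.2 h.symm, hab, hd⟩
  · rw [h1] at hd
    exact ⟨b, a, d.snd, fun h => h2.1 h.symm, hab.symm, hd⟩

theorem three_le_diam {V : Type*} [Fintype V] [DecidableEq V] {G : SimpleGraph V}
    (hG : G.Connected) {x y z : V} (hxy : x ≠ y) (hxz : x ≠ z) (hyz : y ≠ z)
    (h1 : ¬ G.Adj x y) (h2 : ¬ G.Adj x z) : 3 ≤ steinerDiam G 3 := by
  classical
  have hS : ({x, y, z} : Finset V) ∈ (Finset.univ : Finset V).powersetCard 3 := by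
    simp [Finset.mem_powersetCard, Finset.card_eq_three]
    exact ⟨x, y, hxy, z, hxz, hyz, rfl⟩
  refine le_trans ?_ (Finset.le_sup (f := fun S : Finset V => steinerDist G (S : Set V)) hS)
  obtain ⟨H0, a0, b0, -⟩ := steinerLe_univ G hG
  obtain ⟨H, hH, hsub, hm⟩ := Nat.sInf_mem
    (s := {m | ∃ H : G.Subgraph, H.Connected ∧ (({x, y, z} : Finset V) : Set V) ⊆ H.verts ∧
      H.edgeSet.ncard = m}) ⟨_, H0, a0, (Set.subset_univ _).trans b0, rfl⟩
  change 3 ≤ steinerDist G _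
  unfold steinerDist
  rw [← hm]
  have hx : x ∈ H.verts := hsub (by simp)
  have hy : y ∈ H.verts := hsub (by simp)
  have hz : z ∈ H.verts := hsub (by simp)
  have : Nontrivial H.verts := ⟨⟨x, hx⟩, ⟨y, hy⟩, by simpa using hxy⟩
  obtain ⟨⟨w, hw⟩, hxw⟩ := hH.coe.preconnected.exists_adj_of_nontrivial ⟨x, hx⟩
  have hxw' : G.Adj x w := H.adj_sub (by simpa using hxw)
  have hcard := hH.coe.card_vert_le_card_edgeSet_add_one
  have he : H.edgeSet.ncard = Nat.card H.coe.edgeSet := by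
    rw [← Subgraph.image_coe_edgeSet_coe, Set.ncard_image_of_injective _
      (Sym2.map.injective Subtype.val_injective)]
    rfl
  have h4 : 4 ≤ Nat.card H.verts := by
    have : (({x, y, z, w} : Finset V) : Set V) ⊆ H.verts := by
      intro v hv
      simp at hv
      rcases hv with rfl | rfl | rfl | rfl <;> assumption
    have h5 := Set.ncard_le_ncard this
    have hwx := hxw'.ne
    have hwy : y ≠ w := by rintro rfl; exact h1 hxw'
    have hwz : z ≠ w := by rintro rfl; exact h2 hxw'
    have h6 : ({x, y, z, w} : Finset V).card = 4 := by
      simp [*]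
    rw [Set.ncard_coe_finset, h6] at h5
    exact h5
  omega

theorem steinerDiam_three_nordhaus_gaddum {V : Type*} [Fintype V] [DecidableEq V]
    (G : SimpleGraph V) (n : ℕ) (hn : Fintype.card V = n) (hn10 : 10 ≤ n)
    (hG : G.Connected) (hGc : Gᶜ.Connected) :
    (6 ≤ steinerDiam G 3 + steinerDiam Gᶜ 3 ∧
      steinerDiam G 3 + steinerDiam Gᶜ 3 ≤ n + 2) ∧
    (9 ≤ steinerDiam G 3 * steinerDiam Gᶜ 3 ∧
      steinerDiam G 3 * steinerDiam Gᶜ 3 ≤ 3 * (n - 1)) := by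
  have hs : 3 ≤ steinerDiam G 3 := by
    obtain ⟨x, y, z, h1, h2, h3⟩ := exists_path hGc (by omega)
    exact three_le_diam hG h2.ne h3.ne h1 ((compl_adj _ _ _).1 h2).2 ((compl_adj _ _ _).1 h3).2
  have ht : 3 ≤ steinerDiam Gᶜ 3 := by
    obtain ⟨x, y, z, h1, h2, h3⟩ := exists_path hG (by omega)
    exact three_le_diam hGc h2.ne h3.ne h1 (fun h => ((compl_adj _ _ _).1 h).2 h2)
      (fun h => ((compl_adj _ _ _).1 h).2 h3)
  have hs' := diam_le_card hG
  have ht' := diam_le_card hGc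
  have d1 := diam_dichotomy G
  have d2 := diam_dichotomy Gᶜ
  rw [compl_compl] at d2
  generalize steinerDiam G 3 = s at *
  generalize steinerDiam Gᶜ 3 = t at *
  rw [hn] at hs' ht'
  have h9 : 9 ≤ s * t := Nat.mul_le_mul hs ht
  refine ⟨⟨by omega, by omega⟩, h9, ?_⟩
  by_cases c1 : s ≤ 3
  · exact Nat.mul_le_mul c1 ht'
  by_cases c2 : t ≤ 3
  · rw [mul_comm]; exact Nat.mul_le_mul c2 hs'
  have : s * t ≤ 5 * 5 := Nat.mul_le_mul (by omega) (by omega)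
  omega
end

section
/- Let n and k be integers with 2 ≤ k ≤ n, and let T be a tree of order n with exactly r leaves. Then sdiam_k(T) = n − 1 if and only if r ≤ k. -/
open SimpleGraph

lemma steiner_verts_univ {V : Type*} [Fintype V] (T : SimpleGraph V) (hT : T.IsTree)
    (H : T.Subgraph) (hH : H.Connected)
    (hl : {v : V | (T.neighborSet v).ncard = 1} ⊆ H.verts) : ∀ v, v ∈ H.verts := by
  classical
  by_contra! hcon
  obtain ⟨h0, hh0⟩ := hH.nonempty
  obtain ⟨v, hv, hmax⟩ := (Finset.univ.filter (fun v => v ∉ H.verts)).exists_max_image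
    (fun v => T.dist h0 v) (by obtain ⟨x, hx⟩ := hcon; exact ⟨x, by simpa using hx⟩)
  simp only [Finset.mem_filter, Finset.mem_univ, true_and] at hv hmax
  have hne : v ≠ h0 := fun h => hv (h ▸ hh0)
  have : Nontrivial V := ⟨v, h0, hne⟩
  have hup : ∀ a b, T.Adj a b → T.dist h0 b = T.dist h0 a + 1 →
      ∃ p : T.Walk h0 a, ∃ q : T.Walk h0 b, q.IsPath ∧ a ∈ q.support ∧ q.penultimate = a := by
    intro a b hab hd
    obtain ⟨p, hp⟩ := hT.connected.exists_walk_length_eq_dist h0 a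
    refine ⟨p, p.concat hab, ?_, ?_, by simp⟩
    · apply Walk.isPath_of_length_eq_dist
      simp [hp, hd]
    · simp [Walk.support_concat]
  have hnofar : ∀ w, T.Adj v w → T.dist h0 v = T.dist h0 w + 1 := by
    intro w hvw
    rcases hT.dist_eq_dist_add_one_of_adj h0 hvw with h | h
    · exact h
    · exfalso
      have hw : w ∈ H.verts := by
        by_contra hw
        have := hmax w hw
        omega
      obtain ⟨_, q, hq, hvq, _⟩ := hup v w hvw h
      obtain ⟨p, hp⟩ := hH.coe.exists_isPath ⟨h0, hh0⟩ ⟨w, hw⟩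
      have hp' : (p.map H.hom).IsPath := Walk.map_isPath_of_injective Subgraph.hom_injective hp
      have := (hT.existsUnique_path h0 w).unique hq hp'
      rw [this] at hvq
      have hvq' : v ∈ p.support.map H.hom := (Walk.support_map H.hom p) ▸ hvq
      obtain ⟨x, _, hx⟩ := List.mem_map.1 hvq'
      exact hv (hx ▸ x.2)
  apply hv
  apply hl
  obtain ⟨a, ha⟩ := hT.connected.preconnected.exists_adj_of_nontrivial v
  rw [Set.mem_ofPred_eq, Set.ncard_eq_one]
  refine ⟨a, ?_⟩
  ext b
  simp only [mem_neighborSet, Set.mem_singleton_iff]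
  refine ⟨fun hb => ?_, fun h => h ▸ ha⟩
  obtain ⟨_, q, hq, _, h1⟩ := hup a v ha.symm (hnofar a ha)
  obtain ⟨_, q', hq', _, h2⟩ := hup b v hb.symm (hnofar b hb)
  have := (hT.existsUnique_path h0 v).unique hq hq'
  rw [← h1, ← h2, this]

lemma tree_ncard_edge {V : Type*} [Fintype V] (T : SimpleGraph V) (hT : T.IsTree) :
    T.edgeSet.ncard + 1 = Fintype.card V := by
  have := (isTree_iff_connected_and_card.1 hT).2
  rwa [Nat.card_coe_set_eq, Nat.card_eq_fintype_card] at this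

lemma steiner_edge_ge {V : Type*} [Fintype V] (T : SimpleGraph V)
    (H : T.Subgraph) (hH : H.Connected) (hs : ∀ v, v ∈ H.verts) :
    Fintype.card V ≤ H.edgeSet.ncard + 1 := by
  have h1 : H.spanningCoe.Connected :=
    (H.spanningCoeEquivCoeOfSpanning hs).connected_iff.2 hH.coe
  have := h1.card_vert_le_card_edgeSet_add_one
  rwa [Nat.card_coe_set_eq, Nat.card_eq_fintype_card, Subgraph.edgeSet_spanningCoe] at this

lemma steinerDist_le_tree {V : Type*} [Fintype V] (T : SimpleGraph V) (hT : T.IsTree)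
    (S : Set V) : steinerDist T S ≤ Fintype.card V - 1 := by
  apply Nat.sInf_le
  refine ⟨⊤, ?_, by simp, ?_⟩
  · exact ⟨(Subgraph.topIso).connected_iff.2 hT.connected⟩
  · have := tree_ncard_edge T hT
    simp only [Subgraph.edgeSet_top]
    omega

lemma steinerDist_lt_of_leaf {V : Type*} [Fintype V] (T : SimpleGraph V) (hT : T.IsTree)
    (S : Set V) (v : V) (hv : (T.neighborSet v).ncard = 1) (hS : v ∉ S) :
    steinerDist T S < Fintype.card V - 1 := by
  classical
  have hd : T.degree v = 1 := by
    rw [← hv, ← card_neighborSet_eq_degree, Set.ncard_eq_toFinset_card', Set.toFinset_card]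
  have hc := hT.connected.induce_compl_singleton_of_degree_eq_one hd
  obtain ⟨a, ha⟩ := Set.ncard_eq_one.1 hv
  have hva : T.Adj v a := by
    rw [← mem_neighborSet, ha]; rfl
  have hlt : ((⊤ : T.Subgraph).induce {v}ᶜ).edgeSet.ncard < T.edgeSet.ncard := by
    apply Set.ncard_lt_ncard _ (Set.toFinite _)
    refine ⟨Subgraph.edgeSet_subset _, fun h => ?_⟩
    have := h (show s(v, a) ∈ T.edgeSet from hva)
    simp at this
  have := tree_ncard_edge T hT
  refine lt_of_le_of_lt (Nat.sInf_le ⟨(⊤ : T.Subgraph).induce {v}ᶜ, ?_, ?_, rfl⟩) (by omega)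
  · rwa [← connected_induce_iff]
  · intro x hx
    simp only [Subgraph.induce_verts, Set.mem_compl_iff, Set.mem_singleton_iff]
    rintro rfl
    exact hS hx

/-- For a tree `T` of order `n` with exactly `r` leaves and `2 ≤ k ≤ n`,
`sdiam_k(T) = n - 1` if and only if `r ≤ k`. -/
theorem steinerDiam_tree_eq_iff {V : Type*} [Fintype V] [DecidableEq V]
    (T : SimpleGraph V) (n k r : ℕ) (hn : Fintype.card V = n)
    (hk : 2 ≤ k) (hkn : k ≤ n) (hT : T.IsTree)
    (hr : {v : V | (T.neighborSet v).ncard = 1}.ncard = r) :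
    steinerDiam T k = n - 1 ↔ r ≤ k := by
  classical
  subst hn
  rw [Set.ncard_eq_toFinset_card'] at hr
  constructor
  · intro h
    by_contra hlt
    obtain ⟨S, hS, hSe⟩ := Finset.exists_mem_eq_sup (Finset.univ.powersetCard k)
      (Finset.powersetCard_nonempty.2 (by simpa using hkn))
      (fun S : Finset V => steinerDist T (S : Set V))
    rw [Finset.mem_powersetCard_univ] at hS
    obtain ⟨v, hv, hvS⟩ := Finset.exists_mem_notMem_of_card_lt_card
      (show S.card < ({v : V | (T.neighborSet v).ncard = 1}.toFinset).card by omega)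
    have := steinerDist_lt_of_leaf T hT (S : Set V) v (by simpa using hv) (by simpa using hvS)
    unfold steinerDiam at h
    omega
  · intro h
    apply le_antisymm
    · exact Finset.sup_le fun S _ => steinerDist_le_tree T hT _
    · obtain ⟨S, hS, hSc⟩ := Finset.exists_superset_card_eq (n := k) (hr.trans_le h) hkn
      refine le_trans ?_ (Finset.le_sup (f := fun S : Finset V => steinerDist T (S : Set V))
        (Finset.mem_powersetCard_univ.2 hSc))
      apply le_csInf
      · exact ⟨_, ⊤, ⟨(Subgraph.topIso).connected_iff.2 hT.connected⟩, by simp, rfl⟩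
      · rintro m ⟨H, hH, hSH, rfl⟩
        have := steiner_edge_ge T H hH (steiner_verts_univ T hT H hH
          (fun x hx => hSH (hS (by simpa using hx))))
        omega
end

section
/- Let n and k be integers with 2 ≤ k ≤ n, and let G be a connected simple graph of order n. If sdiam_k(G) = k − 1, then the maximum degree of the complement of G is at most k − 2; equivalently, the minimum degree of G is at least n − k + 1. -/
open SimpleGraph

/-- If `sdiam_k(G) = k - 1` for a connected graph `G` of order `n`, then every vertex has
degree at most `k - 2` in the complement of `G`; equivalently, the minimum degree of `G`
is at least `n - k + 1`. -/
theorem maxDegree_compl_le_of_steinerDiam_eq {V : Type*} [Fintype V] [DecidableEq V]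
    (G : SimpleGraph V) (n k : ℕ) (hn : Fintype.card V = n)
    (hk : 2 ≤ k) (hkn : k ≤ n) (hG : G.Connected)
    (h : steinerDiam G k = k - 1) :
    (∀ v : V, (Gᶜ.neighborSet v).ncard ≤ k - 2) ∧
    (∀ v : V, n - k + 1 ≤ (G.neighborSet v).ncard) := by
  have key : ∀ v : V, (Gᶜ.neighborSet v).ncard ≤ k - 2 := by
    intro v
    by_contra hlt
    obtain ⟨T, hTs, hTc⟩ := Set.exists_subset_card_eq
      (show k - 1 ≤ (Gᶜ.neighborSet v).ncard by omega)
    have hvT : v ∉ T := fun hv => by simpa using hTs hv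
    set S : Set V := insert v T with hS
    have hSc : S.ncard = k := by
      rw [hS, Set.ncard_insert_of_notMem hvT]; omega
    have hle : steinerDist G S ≤ k - 1 := by
      rw [← h]
      have hmem : S.toFinite.toFinset ∈ (Finset.univ : Finset V).powersetCard k := by
        rw [Finset.mem_powersetCard]
        exact ⟨Finset.subset_univ _, by rw [← Set.ncard_eq_toFinset_card, hSc]⟩
      have := Finset.le_sup (f := fun S : Finset V => steinerDist G (S : Set V)) hmem
      simp only [Set.Finite.coe_toFinset] at this
      exact this
    obtain ⟨H, hHc, hSH, hHe⟩ : steinerDist G S ∈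
        {m | ∃ H : G.Subgraph, H.Connected ∧ S ⊆ H.verts ∧ H.edgeSet.ncard = m} := by
      apply Nat.sInf_mem
      refine ⟨_, ⊤, ?_, by simp, rfl⟩
      exact ⟨(Subgraph.topIso.connected_iff).2 hG⟩
    have hV : H.verts.ncard ≤ k := by
      have h1 := hHc.coe.card_vert_le_card_edgeSet_add_one
      have h2 : H.edgeSet.ncard = H.coe.edgeSet.ncard := by
        rw [← Subgraph.image_coe_edgeSet_coe]
        exact Set.ncard_image_of_injective _ (Sym2.map.injective Subtype.val_injective)
      rw [Nat.card_coe_set_eq, Nat.card_coe_set_eq] at h1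
      omega
    have hEq : S = H.verts := Set.eq_of_subset_of_ncard_le hSH (by omega)
    have hnt : Nontrivial H.verts := by
      rw [Set.nontrivial_coe_sort, ← hEq, ← Set.one_lt_ncard_iff_nontrivial]
      omega
    obtain ⟨u, hu⟩ := hHc.preconnected.exists_adj_of_nontrivial ⟨v, hSH (by simp [hS])⟩
    have huS : u ∈ S := hEq ▸ hu.snd_mem
    have hGu : G.Adj v u := hu.adj_sub
    rcases huS with rfl | huT
    · exact G.irrefl hGu
    · have := hTs huT
      rw [mem_neighborSet, compl_adj] at this
      exact this.2 hGu
  refine ⟨key, fun v => ?_⟩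
  have h1 := key v
  have h2 : (Gᶜ.neighborSet v).ncard + (G.neighborSet v).ncard + 1 = n := by
    have h3 := Set.ncard_add_ncard_compl (G.neighborSet v)
    have h4 : ((G.neighborSet v)ᶜ \ {v}).ncard + 1 = ((G.neighborSet v)ᶜ).ncard :=
      Set.ncard_sdiff_singleton_add_one (by simp)
    rw [neighborSet_compl]
    rw [Nat.card_eq_fintype_card, hn] at h3
    omega
  omega
end

section
/- Let G be a connected simple graph of order n ≥ 5. If G contains a cycle of length at least 4 (i.e., its circumference c(G) satisfies 4 ≤ c(G) ≤ n), then sdiam_3(G) ≤ n − 2. -/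
open SimpleGraph

/-- `u` is separated by `v` from all the other vertices of `C`. -/
def SepBy {V : Type*} (G : SimpleGraph V) (C : Set V) (v u : V) : Prop :=
  u ≠ v ∧ ∀ c ∈ C, c ≠ v → ∀ p : G.Walk u c, v ∈ p.support

/-- Deleting `u` leaves a (nonempty) connected graph. -/
def NonCut {V : Type*} (G : SimpleGraph V) (u : V) : Prop :=
  ∃ r, r ≠ u ∧ ∀ w, w ≠ u → ∃ p : G.Walk w r, u ∉ p.support

lemma exists_first_hit {V : Type*} {G : SimpleGraph V} (C : Set V) {u c : V}
    (p : G.Walk u c) (hc : c ∈ C) :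
    ∃ c' ∈ C, ∃ q : G.Walk u c', ∀ x ∈ q.support, x ∈ C → x = c' := by
  induction p with
  | nil => exact ⟨_, hc, Walk.nil, by simp⟩
  | @cons a b d h p ih =>
    by_cases ha : a ∈ C
    · exact ⟨a, ha, Walk.nil, by simp⟩
    · obtain ⟨c', hc', q, hq⟩ := ih hc
      refine ⟨c', hc', Walk.cons h q, ?_⟩
      intro x hx hxC
      rw [Walk.support_cons, List.mem_cons] at hx
      rcases hx with rfl | hx
      · exact absurd hxC ha
      · exact hq x hx hxC

lemma sepBy_disjoint {V : Type*} {G : SimpleGraph V} (hG : G.Connected) (C : Set V) {u v w : V}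
    (hv : v ∈ C) (hw : w ∈ C) (hvw : v ≠ w) (h1 : SepBy G C v u) (h2 : SepBy G C w u) : False := by
  obtain ⟨p⟩ := hG.preconnected u v
  obtain ⟨c, hc, q, hq⟩ := exists_first_hit C p hv
  by_cases hcv : c = v
  · have hcw : c ≠ w := by rw [hcv]; exact hvw
    exact hcw (hq w (h2.2 c hc hcw q) hw).symm
  · exact hcv (hq v (h1.2 c hc hcv q) hv).symm

lemma cycle_reach {V : Type*} [DecidableEq V] {G : SimpleGraph V} {a : V} (c : G.Walk a a)
    (hc : c.IsCycle) (v : V) (hv : v ∈ c.support) :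
    ∃ r, r ∈ c.support ∧ G.Adj v r ∧ ∀ x ∈ c.support, x ≠ v →
      ∃ p : G.Walk x r, v ∉ p.support ∧ ∀ y ∈ p.support, y ∈ c.support := by
  have hd := hc.rotate hv
  have hmem : ∀ x, x ∈ (c.rotate v hv).support ↔ x ∈ c.support := by
    intro x
    simp
  generalize c.rotate v hv = d at hd hmem
  cases d with
  | nil => exact absurd rfl hd.ne_nil
  | @cons _ r _ h p =>
    have hp : p.IsPath := (Walk.cons_isCycle_iff p h).1 hd |>.1
    refine ⟨r, (hmem r).1 (by simp), h, ?_⟩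
    intro x hx hxv
    have hxp : x ∈ p.support := by
      have := (hmem x).2 hx
      rw [Walk.support_cons, List.mem_cons] at this
      exact this.resolve_left hxv
    refine ⟨(p.takeUntil x hxp).reverse, ?_, ?_⟩
    · rw [Walk.support_reverse, List.mem_reverse]
      exact Walk.endpoint_notMem_support_takeUntil hp hxp hxv.symm
    · intro y hy
      rw [Walk.support_reverse, List.mem_reverse] at hy
      refine (hmem y).1 ?_
      rw [Walk.support_cons]
      exact List.mem_cons_of_mem _ (p.support_takeUntil_subset_support hxp hy)

lemma nonCut_or {V : Type*} [Fintype V] [DecidableEq V] {G : SimpleGraph V} (hG : G.Connected)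
    {a : V} (c : G.Walk a a) (hc : c.IsCycle) (v : V) (hv : v ∈ c.support) :
    ∃ u, (u = v ∨ SepBy G {x | x ∈ c.support} v u) ∧ NonCut G u := by
  classical
  obtain ⟨r, hrC, hadj, hr⟩ := cycle_reach c hc v hv
  have key : ∀ w, w ≠ v → ¬ SepBy G {x | x ∈ c.support} v w →
      ∃ x ∈ c.support, x ≠ v ∧ ∃ p : G.Walk w x, v ∉ p.support := by
    intro w hw h
    by_contra hcon
    push Not at hcon
    exact h ⟨hw, fun x hx hxv p => hcon x hx hxv p⟩
  by_cases hE : ∃ u, SepBy G {x | x ∈ c.support} v u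
  · obtain ⟨u0, hu0⟩ := hE
    obtain ⟨u, hu, hmax⟩ := Finset.exists_max_image
      (Finset.univ.filter fun u => SepBy G {x | x ∈ c.support} v u) (fun u => G.dist u v)
      ⟨u0, by simpa using hu0⟩
    simp only [Finset.mem_filter, Finset.mem_univ, true_and] at hu hmax
    refine ⟨u, Or.inr hu, v, hu.1.symm, ?_⟩
    have huC : u ∉ c.support := by
      intro h
      have := hu.2 u h hu.1 Walk.nil
      simp at this
      exact hu.1 this.symm
    intro w hwu
    by_cases hwv : w = v
    · subst hwv
      exact ⟨Walk.nil, by simpa using hu.1⟩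
    by_cases hw : SepBy G {x | x ∈ c.support} v w
    · obtain ⟨p, hp⟩ := hG.exists_walk_length_eq_dist w v
      refine ⟨p, fun hup => ?_⟩
      have h1 := hmax w hw
      have h2 := dist_le (p.dropUntil u hup)
      have h3 : (p.takeUntil u hup).length + (p.dropUntil u hup).length = p.length := by
        rw [← Walk.length_append, Walk.take_spec]
      have h4 : (p.takeUntil u hup).length ≠ 0 := fun h => hwu (Walk.eq_of_length_eq_zero h)
      omega
    · obtain ⟨x, hx, hxv, p, hp⟩ := key w hwv hw
      obtain ⟨q, hq1, hq2⟩ := hr x hx hxv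
      refine ⟨(p.append q).append (Walk.cons hadj.symm Walk.nil), ?_⟩
      have hup : u ∉ p.support := by
        intro hup
        have := hu.2 x hx hxv (p.dropUntil u hup)
        exact hp (p.support_dropUntil_subset_support hup this)
      have huq : u ∉ q.support := fun h => huC (hq2 u h)
      have hur : u ≠ r := fun h => huC (h ▸ hrC)
      simp [Walk.mem_support_append_iff, hup, huq, hur, hu.1]
  · push Not at hE
    refine ⟨v, Or.inl rfl, r, hadj.ne', ?_⟩
    intro w hw
    obtain ⟨x, hx, hxv, p, hp⟩ := key w hw (hE w)
    obtain ⟨q, hq1, hq2⟩ := hr x hx hxv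
    exact ⟨p.append q, by simp [Walk.mem_support_append_iff, hp, hq1]⟩

lemma steinerDist_le_of_nonCut {V : Type*} [Fintype V] [DecidableEq V] {G : SimpleGraph V}
    {u : V} (hu : NonCut G u) (S : Set V) (hS : u ∉ S) :
    steinerDist G S ≤ Fintype.card V - 2 := by
  classical
  obtain ⟨r, hr, h⟩ := hu
  have hconn : (G.induce {u}ᶜ).Connected := by
    rw [connected_iff_exists_forall_reachable]
    refine ⟨⟨r, hr⟩, ?_⟩
    rintro ⟨w, hw⟩
    obtain ⟨p, hp⟩ := h w hw
    exact ⟨(p.induce {u}ᶜ (fun x hx hxu => hp (by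
      rw [Set.mem_singleton_iff] at hxu; exact hxu ▸ hx))).reverse⟩
  obtain ⟨T, hT, hTree⟩ := hconn.exists_isTree_le
  have hcard := hTree.card_edgeFinset
  let f : T →g G := (Embedding.induce (G := G) ({u}ᶜ : Set V)).toHom.comp (Hom.ofLE hT)
  have hf : Function.Injective f := fun x y hxy => Subtype.ext hxy
  refine Nat.sInf_le ⟨(⊤ : T.Subgraph).map f, ?_, ?_, ?_⟩
  · rw [Subgraph.connected_iff']
    let g : T →g ((⊤ : T.Subgraph).map f).coe :=
      { toFun := fun x => ⟨f x, x, trivial, rfl⟩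
        map_rel' := fun {x y} hxy => ⟨x, y, hxy, rfl, rfl⟩ }
    refine SimpleGraph.Connected.map g ?_ hTree.connected
    rintro ⟨_, x, _, rfl⟩
    exact ⟨x, rfl⟩
  · intro x hx
    exact ⟨⟨x, fun h => hS (h ▸ hx)⟩, trivial, rfl⟩
  · rw [Subgraph.edgeSet_map, Set.ncard_image_of_injective _ (Sym2.map.injective hf),
      Subgraph.edgeSet_top, ← coe_edgeFinset, Set.ncard_coe_finset]
    have : Fintype.card ({u}ᶜ : Set V) = Fintype.card V - 1 := by
      rw [Fintype.card_compl_set]; simp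
    omega

/-- If a connected graph `G` of order `n ≥ 5` contains a cycle of length at least `4`,
then `sdiam_3(G) ≤ n - 2`. -/
theorem steinerDiam_three_le_of_long_cycle {V : Type*} [Fintype V] [DecidableEq V]
    (G : SimpleGraph V) (n : ℕ) (hn : Fintype.card V = n) (hn5 : 5 ≤ n)
    (hG : G.Connected)
    (hcyc : ∃ (v : V) (c : G.Walk v v), c.IsCycle ∧ 4 ≤ c.length) :
    steinerDiam G 3 ≤ n - 2 := by
  classical
  obtain ⟨a, c, hc, hlen⟩ := hcyc
  subst hn
  refine Finset.sup_le fun S hS => ?_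
  have hS3 := (Finset.mem_powersetCard.1 hS).2
  by_contra hlt
  have hall : ∀ u, NonCut G u → u ∈ S := by
    intro u hu
    by_contra huS
    exact hlt (steinerDist_le_of_nonCut hu S (by simpa using huS))
  have hex : ∀ v, ∃ u, v ∈ c.support →
      (u = v ∨ SepBy G {x | x ∈ c.support} v u) ∧ NonCut G u := by
    intro v
    by_cases hv : v ∈ c.support
    · obtain ⟨u, hu⟩ := nonCut_or hG c hc v hv
      exact ⟨u, fun _ => hu⟩
    · exact ⟨v, fun h => absurd h hv⟩
  choose f hf using hex
  have hle : c.support.tail.toFinset.card ≤ S.card := by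
    have hsub : ∀ {x}, x ∈ c.support.tail.toFinset → x ∈ c.support := fun {x} hx =>
      List.mem_of_mem_tail (List.mem_toFinset.1 hx)
    have hself : ∀ x y, x ∈ c.support → SepBy G {x | x ∈ c.support} y x → False := by
      intro x y hx h
      have := h.2 x hx h.1 Walk.nil
      simp at this
      exact h.1 this.symm
    refine Finset.card_le_card_of_injOn f (fun v hv => hall _ (hf v (hsub hv)).2) ?_
    intro v hv w hw hvw
    have hv := hsub hv
    have hw := hsub hw
    by_contra hne
    rcases (hf v hv).1 with h1 | h1 <;> rcases (hf w hw).1 with h2 | h2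
    · exact hne (h1.symm.trans (hvw.trans h2))
    · rw [← hvw, h1] at h2
      exact hself v w hv h2
    · rw [hvw, h2] at h1
      exact hself w v hw h1
    · rw [hvw] at h1
      exact sepBy_disjoint hG _ hv hw hne h1 h2
  rw [List.toFinset_card_of_nodup hc.support_nodup, List.length_tail, Walk.length_support] at hle
  omega
end

section
/- Let n and k be integers with 2 ≤ k ≤ n, and let G be a connected simple graph of order n. If sdiam_k(G) ≥ 2k, then for every k-element set S of vertices the complement Ḡ admits a connected subgraph with at most k edges whose vertex set contains S; in particular, Ḡ is connected and sdiam_k(Ḡ) ≤ k. -/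
open SimpleGraph

/-- A connected induced graph on `A` contains a tree spanning `A`, with fewer than `|A|` edges. -/
lemma exists_subgraph_of_induce_connected {V : Type*} [Fintype V] [DecidableEq V]
    (G : SimpleGraph V) (A : Finset V) (hA : (G.induce (A : Set V)).Connected) :
    ∃ H : G.Subgraph, H.Connected ∧ (A : Set V) ⊆ H.verts ∧ H.edgeSet.ncard + 1 ≤ A.card := by
  classical
  obtain ⟨T, hT, hTt⟩ := hA.exists_isTree_le
  let H : G.Subgraph :=
    { verts := (A : Set V)
      Adj := fun u v => ∃ (hu : u ∈ (A : Set V)) (hv : v ∈ (A : Set V)), T.Adj ⟨u, hu⟩ ⟨v, hv⟩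
      adj_sub := by
        rintro u v ⟨hu, hv, h⟩
        exact hT h
      edge_vert := by
        rintro u v ⟨hu, hv, h⟩
        exact hu
      symm := ⟨by
        rintro u v ⟨hu, hv, h⟩
        exact ⟨hv, hu, h.symm⟩⟩ }
  have hcoe : H.coe = T := by
    ext ⟨u, hu⟩ ⟨v, hv⟩
    constructor
    · rintro ⟨_, _, h⟩
      exact h
    · intro h
      exact ⟨hu, hv, h⟩
  refine ⟨H, ⟨?_⟩, subset_rfl, ?_⟩
  · rw [hcoe]
    exact hTt.connected
  · have hsub : H.edgeSet ⊆ Sym2.map Subtype.val '' T.edgeSet := by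
      intro e
      induction e with
      | _ u v =>
        rintro ⟨hu, hv, h⟩
        exact ⟨s(⟨u, hu⟩, ⟨v, hv⟩), h, rfl⟩
    have h1 := Set.ncard_le_ncard hsub (Set.toFinite _)
    have h2 := Set.ncard_image_le (f := Sym2.map Subtype.val) (Set.toFinite T.edgeSet)
    have h3 := hTt.card_edgeFinset
    have h4 : T.edgeSet.ncard = T.edgeFinset.card := by
      rw [← coe_edgeFinset, Set.ncard_coe_finset]
    have h5 : Fintype.card ((A : Set V) : Type _) = A.card := by simp
    omega

/-- Attaching vertices adjacent to a connected set keeps it connected. -/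
lemma induce_connected_of_dominated {V : Type*} (G : SimpleGraph V) (A B : Set V) (hAB : A ⊆ B)
    (hA : (G.induce A).Connected) (hB : ∀ b ∈ B, b ∈ A ∨ ∃ a ∈ A, G.Adj a b) :
    (G.induce B).Connected := by
  obtain ⟨⟨a₀, ha₀⟩⟩ := hA.nonempty
  have key : ∀ a (ha : a ∈ A), (G.induce B).Reachable ⟨a₀, hAB ha₀⟩ ⟨a, hAB ha⟩ := by
    intro a ha
    exact (hA.preconnected ⟨a₀, ha₀⟩ ⟨a, ha⟩).map (G.induceHomOfLE hAB).toHom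
  rw [connected_iff_exists_forall_reachable]
  refine ⟨⟨a₀, hAB ha₀⟩, ?_⟩
  rintro ⟨b, hb⟩
  rcases hB b hb with h | ⟨a, ha, hab⟩
  · exact key b h
  · refine (key a ha).trans (Adj.reachable ?_)
    exact hab

lemma exists_compl_subgraph {V : Type*} [Fintype V] [DecidableEq V]
    (G : SimpleGraph V) (k : ℕ) (hk : 2 ≤ k) (h : 2 * k ≤ steinerDiam G k)
    (S : Finset V) (hS : S.card = k) :
    ∃ H : Gᶜ.Subgraph, H.Connected ∧ (S : Set V) ⊆ H.verts ∧ H.edgeSet.ncard ≤ k := by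
  have hne : S.Nonempty := by
    rw [← Finset.card_pos]; omega
  have : Nonempty (S : Set V) := hne.to_subtype
  rcases (G.induce (S : Set V)).connected_or_connected_compl with hc | hc
  · by_cases hd : ∀ v, v ∈ S ∨ ∃ a ∈ S, G.Adj a v
    · exfalso
      have hle : steinerDiam G k ≤ 2 * k - 1 := by
        refine Finset.sup_le ?_
        intro T hT
        have hTk : T.card = k := (Finset.mem_powersetCard.mp hT).2
        have hcon : (G.induce ((S ∪ T : Finset V) : Set V)).Connected := by
          refine induce_connected_of_dominated G (S : Set V) _ ?_ hc ?_
          · intro x hx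
            simp only [Finset.coe_union]
            exact Or.inl hx
          · intro b _
            exact hd b
        obtain ⟨H, hH, hs, hcard⟩ := exists_subgraph_of_induce_connected G _ hcon
        have hu := Finset.card_union_le S T
        refine (Nat.sInf_le ⟨H, hH, ?_, rfl⟩ : steinerDist G (T : Set V) ≤ _).trans (by omega)
        intro x hx
        apply hs
        simp only [Finset.coe_union]
        exact Or.inr hx
      omega
    · push Not at hd
      obtain ⟨v, hv, hadj⟩ := hd
      have hcon : (Gᶜ.induce ((insert v S : Finset V) : Set V)).Connected := by
        refine induce_connected_of_dominated Gᶜ {v} _ ?_ ?_ ?_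
        · simp
        · exact Connected.of_subsingleton
        · intro b hb
          rcases Finset.mem_insert.mp (Finset.mem_coe.mp hb) with rfl | hb
          · exact Or.inl rfl
          · refine Or.inr ⟨v, rfl, ?_⟩
            rw [compl_adj]
            exact ⟨fun e => hv (e ▸ hb), fun e => hadj b hb e.symm⟩
      obtain ⟨H, hH, hs, hcard⟩ := exists_subgraph_of_induce_connected Gᶜ _ hcon
      rw [Finset.card_insert_of_notMem hv] at hcard
      refine ⟨H, hH, fun x hx => hs ?_, by omega⟩
      exact Finset.mem_coe.mpr (Finset.mem_insert_of_mem hx)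
  · have hcon : (Gᶜ.induce (S : Set V)).Connected := by
      convert hc using 1
      ext a b
      simp only [comap_adj, compl_adj, Function.Embedding.subtype_apply, ne_eq, Subtype.ext_iff]
    obtain ⟨H, hH, hs, hcard⟩ := exists_subgraph_of_induce_connected Gᶜ _ hcon
    exact ⟨H, hH, hs, by omega⟩

/-- If `sdiam_k(G) ≥ 2k` for a connected graph `G` of order `n` with `2 ≤ k ≤ n`, then for
every `k`-element vertex set `S`, the complement `Ḡ` has a connected subgraph with at most
`k` edges whose vertex set contains `S`; in particular, `Ḡ` is connected and
`sdiam_k(Ḡ) ≤ k`. -/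
theorem steinerDiam_compl_le_of_steinerDiam_ge {V : Type*} [Fintype V] [DecidableEq V]
    (G : SimpleGraph V) (n k : ℕ) (hn : Fintype.card V = n)
    (hk : 2 ≤ k) (hkn : k ≤ n) (hG : G.Connected)
    (h : 2 * k ≤ steinerDiam G k) :
    (∀ S : Finset V, S.card = k →
      ∃ H : Gᶜ.Subgraph, H.Connected ∧ (S : Set V) ⊆ H.verts ∧ H.edgeSet.ncard ≤ k) ∧
    Gᶜ.Connected ∧ steinerDiam Gᶜ k ≤ k := by
  have main := exists_compl_subgraph G k hk h
  refine ⟨main, ?_, ?_⟩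
  · have := hG.nonempty
    refine ⟨fun u v => ?_⟩
    obtain ⟨S, hS, hSk⟩ := Finset.exists_superset_card_eq (s := {u, v}) (n := k)
      (Finset.card_le_two.trans hk) (by omega)
    obtain ⟨H, hH, hs, -⟩ := main S hSk
    have hu : u ∈ H.verts := hs (hS (by simp))
    have hv : v ∈ H.verts := hs (hS (by simp))
    exact (hH.coe.preconnected ⟨u, hu⟩ ⟨v, hv⟩).map H.hom
  · refine Finset.sup_le ?_
    intro T hT
    obtain ⟨H, hH, hs, hcard⟩ := main T (Finset.mem_powersetCard.mp hT).2
    exact (Nat.sInf_le ⟨H, hH, hs, rfl⟩ : steinerDist Gᶜ (T : Set V) ≤ _).trans hcard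
end
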